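/- arXiv:gr-qc/0505022 — 2 statements merged into one kernel-verified Lean document; each statement's English description precedes it below -/
import Mathlib

section
/- Let n ≥ 3 and let Ω ⊂ ℝⁿ be a nonempty bounded open convex set (a Lipschitz domain). Then there exists a constant C > 0, independent of u, such that for every smooth vector field u : ℝⁿ → ℝⁿ one has ∫_Ω (|u|² + |Du|²) dμ ≤ C ∫_Ω (|u|² + |l(u)|²) dμ, where |u|² = Σ_i u_i². -/
open MeasureTheory Finset

/-- Partial derivative `∂ᵢ f` of a scalar function on `ℝⁿ`. -/
noncomputable def pd {n : ℕ} (f : (Fin n → ℝ) → ℝ) (i : Fin n) (x : Fin n → ℝ) : ℝ :=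
  fderiv ℝ f x (Pi.single i 1)

/-- Linearized strain tensor `e_{ij}(u) = (∂ᵢ u_j + ∂ⱼ u_i)/2`. -/
noncomputable def strain {n : ℕ} (u : (Fin n → ℝ) → Fin n → ℝ) (i j : Fin n)
    (x : Fin n → ℝ) : ℝ :=
  (pd (fun y => u y j) i x + pd (fun y => u y i) j x) / 2

/-- The trace `e(u) = Σᵢ ∂ᵢ uᵢ`, i.e. the divergence of `u`. -/
noncomputable def diver {n : ℕ} (u : (Fin n → ℝ) → Fin n → ℝ) (x : Fin n → ℝ) : ℝ :=
  ∑ i, pd (fun y => u y i) i x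

/-- Trace-free part `l_{ij}(u) = e_{ij}(u) − (1/n) e(u) δ_{ij}`. -/
noncomputable def ltf {n : ℕ} (u : (Fin n → ℝ) → Fin n → ℝ) (i j : Fin n)
    (x : Fin n → ℝ) : ℝ :=
  strain u i j x - (1 / (n : ℝ)) * diver u x * (if i = j then 1 else 0)

section Calculus

variable {n : ℕ}

lemma contDiff_pd {f : (Fin n → ℝ) → ℝ} (hf : ContDiff ℝ (⊤ : ℕ∞) f) (i : Fin n) :
    ContDiff ℝ (⊤ : ℕ∞) (pd f i) :=
  (hf.fderiv_right (m := (⊤ : ℕ∞)) (by simp)).clm_apply contDiff_const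

lemma pd_comm {f : (Fin n → ℝ) → ℝ} (hf : ContDiff ℝ (⊤ : ℕ∞) f) (i j : Fin n) :
    pd (pd f i) j = pd (pd f j) i := by
  have hd : Differentiable ℝ (fderiv ℝ f) :=
    (hf.fderiv_right (m := (⊤ : ℕ∞)) (by simp)).differentiable (by simp)
  have key : ∀ (x : Fin n → ℝ) (a b : Fin n), pd (pd f a) b x =
      fderiv ℝ (fderiv ℝ f) x (Pi.single b 1) (Pi.single a 1) := by
    intro x a b
    change fderiv ℝ (fun y => fderiv ℝ f y (Pi.single a 1)) x (Pi.single b 1) = _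
    rw [fderiv_clm_apply (hd x) (differentiableAt_const _)]
    simp
  funext x
  rw [key, key]
  exact (hf.contDiffAt.isSymmSndFDerivAt (by
    rw [minSmoothness_of_isRCLikeNormedField]; exact WithTop.coe_le_coe.2 le_top)) _ _

lemma pd_add {f g : (Fin n → ℝ) → ℝ} (hf : ContDiff ℝ (⊤ : ℕ∞) f)
    (hg : ContDiff ℝ (⊤ : ℕ∞) g) (i : Fin n) (x : Fin n → ℝ) :
    pd (fun y => f y + g y) i x = pd f i x + pd g i x := by
  simp only [pd]
  rw [fderiv_fun_add (hf.differentiable (by simp) x) (hg.differentiable (by simp) x)]; rfl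

lemma pd_sub {f g : (Fin n → ℝ) → ℝ} (hf : ContDiff ℝ (⊤ : ℕ∞) f)
    (hg : ContDiff ℝ (⊤ : ℕ∞) g) (i : Fin n) (x : Fin n → ℝ) :
    pd (fun y => f y - g y) i x = pd f i x - pd g i x := by
  simp only [pd]
  rw [fderiv_fun_sub (hf.differentiable (by simp) x) (hg.differentiable (by simp) x)]; rfl

lemma pd_const_mul {f : (Fin n → ℝ) → ℝ} (hf : ContDiff ℝ (⊤ : ℕ∞) f) (c : ℝ)
    (i : Fin n) (x : Fin n → ℝ) :
    pd (fun y => c * f y) i x = c * pd f i x := by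
  simp only [pd]
  rw [fderiv_const_mul (hf.differentiable (by simp) x)]; rfl

lemma pd_sum {ι : Type*} (s : Finset ι) {f : ι → (Fin n → ℝ) → ℝ}
    (hf : ∀ a, ContDiff ℝ (⊤ : ℕ∞) (f a)) (i : Fin n) (x : Fin n → ℝ) :
    pd (fun y => ∑ a ∈ s, f a y) i x = ∑ a ∈ s, pd (f a) i x := by
  simp only [pd]
  rw [fderiv_fun_sum (fun a _ => (hf a).differentiable (by simp) x)]
  simp

lemma pd_eq_zero_of_notMem {f : (Fin n → ℝ) → ℝ} {K : Set (Fin n → ℝ)} (hK : IsClosed K)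
    (hf : ∀ x, x ∉ K → f x = 0) (i : Fin n) (x : Fin n → ℝ) (hx : x ∉ K) : pd f i x = 0 := by
  have : f =ᶠ[nhds x] fun _ => 0 := by
    filter_upwards [hK.isOpen_compl.mem_nhds hx] with y hy using hf y hy
  rw [pd, this.fderiv_eq]; simp

lemma fderiv_apply_eq_sum_pd (g : (Fin n → ℝ) → ℝ) (z v : Fin n → ℝ) :
    fderiv ℝ g z v = ∑ k, v k * pd g k z := by
  have e : v = ∑ k, v k • (Pi.single k 1 : Fin n → ℝ) := by
    have := pi_eq_sum_univ' v
    simpa [Pi.single_apply, eq_comm] using this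
  conv_lhs => rw [e]
  simp [map_sum, pd]

/-- Integration by parts, one of the factors vanishing off a compact set. -/
lemma integral_mul_pd {f g : (Fin n → ℝ) → ℝ} (hf : ContDiff ℝ (⊤ : ℕ∞) f)
    (hg : ContDiff ℝ (⊤ : ℕ∞) g) {K : Set (Fin n → ℝ)} (hK : IsCompact K)
    (hfK : ∀ x, x ∉ K → f x = 0) (i : Fin n) :
    ∫ x, f x * pd g i x = - ∫ x, pd f i x * g x := by
  have hint : ∀ F G : (Fin n → ℝ) → ℝ, Continuous F → Continuous G → (∀ x, x ∉ K → F x = 0) →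
      Integrable (fun x => F x * G x) := fun F G hF hG h =>
    (hF.mul hG).integrable_of_hasCompactSupport
      (HasCompactSupport.intro hK fun x hx => by simp [h x hx])
  exact integral_mul_fderiv_eq_neg_fderiv_mul_of_integrable
    (hint _ _ (contDiff_pd hf i).continuous hg.continuous
      (pd_eq_zero_of_notMem hK.isClosed hfK i))
    (hint _ _ hf.continuous (contDiff_pd hg i).continuous hfK)
    (hint _ _ hf.continuous hg.continuous hfK)
    (fun x _ => hf.differentiable (by simp) x) (fun x _ => hg.differentiable (by simp) x)

variable {u : (Fin n → ℝ) → Fin n → ℝ}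

lemma contDiff_strain (hu : ∀ j, ContDiff ℝ (⊤ : ℕ∞) (fun x => u x j)) (i j : Fin n) :
    ContDiff ℝ (⊤ : ℕ∞) (strain u i j) :=
  ((contDiff_pd (hu j) i).add (contDiff_pd (hu i) j)).div_const 2

lemma contDiff_diver (hu : ∀ j, ContDiff ℝ (⊤ : ℕ∞) (fun x => u x j)) :
    ContDiff ℝ (⊤ : ℕ∞) (diver u) :=
  ContDiff.sum fun i _ => contDiff_pd (hu i) i

lemma contDiff_ltf (hu : ∀ j, ContDiff ℝ (⊤ : ℕ∞) (fun x => u x j)) (i j : Fin n) :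
    ContDiff ℝ (⊤ : ℕ∞) (ltf u i j) :=
  (contDiff_strain hu i j).sub ((contDiff_const.mul (contDiff_diver hu)).mul contDiff_const)

lemma pd_ltf (hu : ∀ j, ContDiff ℝ (⊤ : ℕ∞) (fun x => u x j)) (i j a : Fin n) :
    pd (ltf u i j) a = ltf (fun x k => pd (fun y => u y k) a x) i j := by
  have h1 : ∀ p q, ContDiff ℝ (⊤ : ℕ∞) (pd (fun y => u y p) q) := fun p q => contDiff_pd (hu p) q
  have e : ltf u i j = fun x => ((1 / 2 : ℝ) * pd (fun y => u y j) i x +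
      (1 / 2 : ℝ) * pd (fun y => u y i) j x) -
      ((1 / (n : ℝ)) * (if i = j then 1 else 0)) * ∑ k, pd (fun y => u y k) k x := by
    funext x; simp only [ltf, strain, diver]; ring
  funext x
  rw [e, pd_sub ((contDiff_const.mul (h1 _ _)).add (contDiff_const.mul (h1 _ _)))
      (contDiff_const.mul (ContDiff.sum fun k _ => h1 k k)),
    pd_add (contDiff_const.mul (h1 _ _)) (contDiff_const.mul (h1 _ _)),
    pd_const_mul (h1 _ _), pd_const_mul (h1 _ _),
    pd_const_mul (ContDiff.sum fun k _ => h1 k k), pd_sum _ (fun k => h1 k k)]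
  simp only [ltf, strain, diver]
  rw [pd_comm (hu j) i a, pd_comm (hu i) j a,
    Finset.sum_congr rfl fun k _ => congrFun (pd_comm (hu k) k a) x]
  ring

end Calculus

/-- An array with the symmetries of third derivatives `∂_a ∂_b ∂_c u_j` is controlled by the
array that it induces on the trace-free strain. This is where `n ≥ 3` is needed. -/
lemma abs_le_of_traceFree_le {n : ℕ} (hn : 3 ≤ n) (N : Fin n → Fin n → Fin n → Fin n → ℝ)
    (h12 : ∀ a b c j, N a b c j = N b a c j) (h23 : ∀ a b c j, N a b c j = N a c b j) (M : ℝ)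
    (h : ∀ i j a b, |(N i a b j + N j a b i) / 2 -
      (1 / (n : ℝ)) * (∑ k, N k a b k) * (if i = j then 1 else 0)| ≤ M) (a b c j : Fin n) :
    |N a b c j| ≤ 21 * M := by
  set T : Fin n → Fin n → ℝ := fun a b => (1 / (n : ℝ)) * (∑ k, N k a b k) with hT
  have hoff : ∀ i j a b, i ≠ j → |(N i a b j + N j a b i) / 2| ≤ M := by
    intro i j a b hij
    simpa [hij] using h i j a b
  have hdiag : ∀ i a b, |N i a b i - T a b| ≤ M := by
    intro i a b
    have := h i i a b
    simp only [if_true, mul_one] at this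
    convert this using 2
    simp only [hT]; ring
  have exists_ne : ∀ a b : Fin n, ∃ i, i ≠ a ∧ i ≠ b := by
    intro a b
    have : ({a, b} : Finset (Fin n)).card < (univ : Finset (Fin n)).card := by
      calc _ ≤ 2 := Finset.card_le_two
        _ < _ := by simp; omega
    obtain ⟨i, -, hi⟩ := Finset.exists_mem_notMem_of_card_lt_card this
    exact ⟨i, by simpa [not_or] using hi⟩
  have hM : 0 ≤ M := (abs_nonneg _).trans (hdiag a a a)
  have hToff : ∀ a b, a ≠ b → |T a b| ≤ 4 * M := by
    intro a b hab
    obtain ⟨i, hia, hib⟩ := exists_ne a b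
    have e1 := hdiag i a b
    have e2 := hoff a b i i hab
    have e3 := hoff i b a i hib
    have e4 := hoff a i i b hia.symm
    rw [abs_le] at *
    have s1 := h12 a i i b
    have s2 := h12 b i i a
    have s3 := h23 i a i b
    have s4 := h23 i b i a
    have s5 := h23 i a b i
    have s6 := h12 b a i i
    have s7 := h23 b a i i
    have s8 := h12 b i a i
    have s9 := h12 a i b i
    constructor <;> linarith
  have hsum : ∀ a i, a ≠ i → |T a a + T i i| ≤ 4 * M := by
    intro a i hai
    have e1 := hdiag i a a
    have e2 := hdiag a i i
    have e3 := hoff i a a i hai.symm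
    rw [abs_le] at *
    have s1 := h12 a i i a
    have s3 := h23 i a i a
    have s2 := h12 i a a i
    have s4 := h23 a i a i
    constructor <;> linarith
  have hTd : ∀ a, |T a a| ≤ 6 * M := by
    intro a
    obtain ⟨i, hia, -⟩ := exists_ne a a
    obtain ⟨k, hka, hki⟩ := exists_ne a i
    have e1 := hsum a i hia.symm
    have e2 := hsum a k hka.symm
    have e3 := hsum i k hki.symm
    rw [abs_le] at *
    constructor <;> linarith
  have hTall : ∀ a b, |T a b| ≤ 6 * M := by
    intro a b
    by_cases hab : a = b
    · exact hab ▸ hTd a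
    · exact (hToff a b hab).trans (by linarith)
  have hE : ∀ i j a b, |(N i a b j + N j a b i) / 2| ≤ 7 * M := by
    intro i j a b
    by_cases hij : i = j
    · subst hij
      have e1 := hdiag i a b
      have e2 := hTall a b
      rw [abs_le] at *
      constructor <;> linarith
    · exact (hoff i j a b hij).trans (by linarith)
  have e1 := hE a j b c
  have e2 := hE b j a c
  have e3 := hE b a c j
  rw [abs_le] at *
  have s1 := h12 j b c a
  have s2 := h12 a b c j
  have s3 := h12 j a c b
  have s4 := h23 b c j a
  have s5 := h23 b j c a
  have s6 := h23 a c j b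
  have s7 := h12 b c j a
  have s8 := h12 a c j b
  have s9 := h12 a j c b
  constructor <;> linarith

section Korn

variable {n : ℕ}

lemma sum_sq_ltf (hn : n ≠ 0) (u : (Fin n → ℝ) → Fin n → ℝ) (x : Fin n → ℝ) :
    2 * ∑ i, ∑ j, ltf u i j x ^ 2 = (∑ i, ∑ j, pd (fun y => u y j) i x ^ 2) +
      (∑ i, ∑ j, pd (fun y => u y j) i x * pd (fun y => u y i) j x) -
      2 / (n : ℝ) * diver u x ^ 2 := by
  have hn' : (n : ℝ) ≠ 0 := by exact_mod_cast hn
  have e : ∀ i j, 2 * ltf u i j x ^ 2 =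
      (1 / 2 : ℝ) * pd (fun y => u y j) i x ^ 2 + (1 / 2 : ℝ) * pd (fun y => u y i) j x ^ 2 +
      pd (fun y => u y j) i x * pd (fun y => u y i) j x +
      (if i = j then (2 / (n : ℝ) ^ 2 * diver u x ^ 2 -
        4 / (n : ℝ) * diver u x * pd (fun y => u y i) i x) else 0) := by
    intro i j
    by_cases h : i = j
    · subst h
      simp only [ltf, strain, if_true]; ring
    · simp only [ltf, strain, h, if_false]; ring
  simp only [Finset.mul_sum, e, Finset.sum_add_distrib, Finset.sum_ite_eq, Finset.mem_univ,
    if_true, Finset.sum_sub_distrib]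
  rw [Finset.sum_comm (f := fun i j => (1 / 2 : ℝ) * pd (fun y => u y i) j x ^ 2)]
  simp only [← Finset.mul_sum, Finset.sum_const, Finset.card_univ, Fintype.card_fin,
    nsmul_eq_mul]
  have : ∑ i, pd (fun y => u y i) i x = diver u x := rfl
  rw [this]
  field_simp
  ring

/-- The trace-free Korn inequality for compactly supported fields. -/
lemma integral_sq_pd_le_of_compact (hn : 2 ≤ n) {v : (Fin n → ℝ) → Fin n → ℝ}
    (hv : ∀ j, ContDiff ℝ (⊤ : ℕ∞) (fun x => v x j)) {K : Set (Fin n → ℝ)} (hK : IsCompact K)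
    (hvK : ∀ x, x ∉ K → v x = 0) :
    ∫ x, ∑ i, ∑ j, pd (fun y => v y j) i x ^ 2 ≤ 2 * ∫ x, ∑ i, ∑ j, ltf v i j x ^ 2 := by
  have h0 : ∀ j x, x ∉ K → v x j = 0 := fun j x hx => by rw [hvK x hx]; rfl
  have hp0 : ∀ i j x, x ∉ K → pd (fun y => v y j) i x = 0 := fun i j =>
    pd_eq_zero_of_notMem hK.isClosed (h0 j) i
  have hpc : ∀ i j, ContDiff ℝ (⊤ : ℕ∞) (pd (fun y => v y j) i) := fun i j => contDiff_pd (hv j) i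
  have hint : ∀ i j k l, Integrable
      (fun x => pd (fun y => v y j) i x * pd (fun y => v y k) l x) := fun i j k l =>
    ((hpc i j).continuous.mul (hpc l k).continuous).integrable_of_hasCompactSupport
      (HasCompactSupport.intro hK fun x hx => by simp [hp0 i j x hx])
  have hswap : ∀ i j, ∫ x, pd (fun y => v y j) i x * pd (fun y => v y i) j x =
      ∫ x, pd (fun y => v y j) j x * pd (fun y => v y i) i x := by
    intro i j
    rw [integral_mul_pd (hpc i j) (hv i) hK (hp0 i j), pd_comm (hv j) i j,
      ← integral_mul_pd (hpc j j) (hv i) hK (hp0 j j)]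
  have hdiv : ∀ x, diver v x ^ 2 =
      ∑ i, ∑ j, pd (fun y => v y j) j x * pd (fun y => v y i) i x := by
    intro x
    rw [sq, diver, Finset.sum_mul_sum, Finset.sum_comm]
  have hI1 : Integrable fun x => ∑ i, ∑ j, pd (fun y => v y j) i x ^ 2 := by
    simp only [sq]
    exact integrable_finsetSum _ fun i _ => integrable_finsetSum _ fun j _ => hint _ _ _ _
  have hI2 : Integrable fun x => ∑ i, ∑ j, pd (fun y => v y j) i x * pd (fun y => v y i) j x :=
    integrable_finsetSum _ fun i _ => integrable_finsetSum _ fun j _ => hint _ _ _ _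
  have hI3 : Integrable fun x => diver v x ^ 2 := by
    simp only [hdiv]
    exact integrable_finsetSum _ fun i _ => integrable_finsetSum _ fun j _ => hint _ _ _ _
  have h2 : ∫ x, ∑ i, ∑ j, pd (fun y => v y j) i x * pd (fun y => v y i) j x =
      ∫ x, diver v x ^ 2 := by
    simp only [hdiv]
    rw [integral_finsetSum _ fun i _ => integrable_finsetSum _ fun j _ => hint _ _ _ _,
      integral_finsetSum _ fun i _ => integrable_finsetSum _ fun j _ => hint _ _ _ _]
    refine Finset.sum_congr rfl fun i _ => ?_
    rw [integral_finsetSum _ fun j _ => hint _ _ _ _, integral_finsetSum _ fun j _ => hint _ _ _ _]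
    exact Finset.sum_congr rfl fun j _ => hswap i j
  rw [← integral_const_mul]
  simp only [sum_sq_ltf (show n ≠ 0 by omega) v]
  have hI12 : Integrable fun x => (∑ i, ∑ j, pd (fun y => v y j) i x ^ 2) +
      ∑ i, ∑ j, pd (fun y => v y j) i x * pd (fun y => v y i) j x := hI1.add hI2
  rw [integral_sub hI12 (hI3.const_mul _), integral_add hI1 hI2, h2,
    integral_const_mul]
  have h3 : 0 ≤ ∫ x, diver v x ^ 2 := integral_nonneg fun x => sq_nonneg _
  have h4 : 2 / (n : ℝ) ≤ 1 := by
    rw [div_le_one (by positivity)]; exact_mod_cast hn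
  nlinarith

end Korn

section Average

variable {n : ℕ}

/-- Smooth kernels `G x y` supported in `y ∈ K`. -/
def IsKernel (K : Set (Fin n → ℝ)) (G : (Fin n → ℝ) → (Fin n → ℝ) → ℝ) : Prop :=
  ContDiff ℝ (⊤ : ℕ∞) (fun p : (Fin n → ℝ) × (Fin n → ℝ) => G p.1 p.2) ∧
    ∀ x y, y ∉ K → G x y = 0

namespace IsKernel

variable {K : Set (Fin n → ℝ)} {G : (Fin n → ℝ) → (Fin n → ℝ) → ℝ}

lemma contDiff_right (hG : IsKernel K G) (x : Fin n → ℝ) : ContDiff ℝ (⊤ : ℕ∞) (G x) :=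
  hG.1.comp (contDiff_const.prodMk contDiff_id)

lemma pd_right (hG : IsKernel K G) (hK : IsClosed K) (k : Fin n) :
    IsKernel K (fun x => pd (G x) k) := by
  refine ⟨?_, fun x y hy => pd_eq_zero_of_notMem hK (hG.2 x) k y hy⟩
  have e : (fun p : (Fin n → ℝ) × (Fin n → ℝ) => pd (G p.1) k p.2) = fun p =>
      fderiv ℝ (fun p : (Fin n → ℝ) × (Fin n → ℝ) => G p.1 p.2) p (0, Pi.single k 1) := by
    funext p
    have h1 : HasFDerivAt (fun p : (Fin n → ℝ) × (Fin n → ℝ) => G p.1 p.2)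
        (fderiv ℝ (fun p : (Fin n → ℝ) × (Fin n → ℝ) => G p.1 p.2) p) (p.1, p.2) :=
      (hG.1.differentiable (by simp) p).hasFDerivAt
    have h2 := h1.comp p.2 (hasFDerivAt_prodMk_right p.1 p.2)
    have h3 : fderiv ℝ (G p.1) p.2 = _ := h2.fderiv
    rw [pd, h3]; simp
  rw [e]
  exact (hG.1.fderiv_right (m := (⊤ : ℕ∞)) (by simp)).clm_apply contDiff_const

lemma mul_sub (hG : IsKernel K G) (k : Fin n) : IsKernel K (fun x y => G x y * (y k - x k)) :=
  ⟨hG.1.mul (((contDiff_apply ℝ ℝ k).comp contDiff_snd).sub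
    ((contDiff_apply ℝ ℝ k).comp contDiff_fst)), fun x y hy => by simp [hG.2 x y hy]⟩

lemma exists_bound (hG : IsKernel K G) (hK : IsCompact K) {Ω : Set (Fin n → ℝ)}
    (hΩ : Bornology.IsBounded Ω) : ∃ C, 0 < C ∧ ∀ x ∈ Ω, ∀ y, |G x y| ≤ C := by
  obtain ⟨C, hC⟩ := (hΩ.isCompact_closure.prod hK).exists_bound_of_continuousOn
    hG.1.continuous.continuousOn
  refine ⟨max C 1, by positivity, fun x hx y => ?_⟩
  by_cases hy : y ∈ K
  · exact (hC (x, y) ⟨subset_closure hx, hy⟩).trans (le_max_left _ _)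
  · rw [hG.2 x y hy]; simp

end IsKernel

/-- Differentiation under the integral sign for integrands supported in a fixed compact set. -/
lemma hasDerivAt_integral_of_compact {F F' : ℝ → (Fin n → ℝ) → ℝ} {K : Set (Fin n → ℝ)}
    (hK : IsCompact K) (hF : ∀ s, Continuous (F s))
    (hF' : Continuous fun p : ℝ × (Fin n → ℝ) => F' p.1 p.2)
    (hFK : ∀ s y, y ∉ K → F s y = 0) (hFK' : ∀ s y, y ∉ K → F' s y = 0)
    (hd : ∀ s y, HasDerivAt (fun s => F s y) (F' s y) s) (s : ℝ) :
    HasDerivAt (fun s => ∫ y, F s y) (∫ y, F' s y) s := by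
  obtain ⟨C, hC⟩ := ((isCompact_Icc (a := s - 1) (b := s + 1)).prod hK).exists_bound_of_continuousOn
    hF'.continuousOn
  refine (hasDerivAt_integral_of_dominated_loc_of_deriv_le (bound := K.indicator fun _ => C)
    (Icc_mem_nhds (by linarith : s - 1 < s) (by linarith : s < s + 1)) ?_ ?_ ?_ ?_ ?_ ?_).2
  · exact Filter.Eventually.of_forall fun t => (hF t).aestronglyMeasurable
  · exact (hF s).integrable_of_hasCompactSupport (HasCompactSupport.intro hK (hFK s))
  · exact (hF'.comp (Continuous.prodMk_right s)).aestronglyMeasurable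
  · refine Filter.Eventually.of_forall fun y t ht => ?_
    by_cases hy : y ∈ K
    · simpa [hy] using hC (t, y) ⟨ht, hy⟩
    · simp [hy, hFK' t y hy]
  · exact (integrable_indicator_iff hK.measurableSet).2
      (integrableOn_const hK.measure_lt_top.ne)
  · exact Filter.Eventually.of_forall fun y t _ => hd t y

/-- The weighted average of `g` over the homothetic copy of the weight `f` that shrinks to `x`
as `τ → 0`. -/
noncomputable def homAvg (f g : (Fin n → ℝ) → ℝ) (x : Fin n → ℝ) (τ : ℝ) : ℝ :=
  ∫ y, f y * g (x + τ • (y - x))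

lemma pd_comp_homothety {g : (Fin n → ℝ) → ℝ} (hg : ContDiff ℝ (⊤ : ℕ∞) g) (x : Fin n → ℝ)
    (τ : ℝ) (k : Fin n) (y : Fin n → ℝ) :
    pd (fun y => g (x + τ • (y - x))) k y = τ * pd g k (x + τ • (y - x)) := by
  have h1 : HasFDerivAt (fun y : Fin n → ℝ => x + τ • (y - x))
      (τ • ContinuousLinearMap.id ℝ (Fin n → ℝ)) y :=
    (((hasFDerivAt_id y).sub_const x).const_smul τ).const_add x
  have h2 := (hg.differentiable (by simp) (x + τ • (y - x))).hasFDerivAt.comp y h1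
  have h3 : fderiv ℝ (fun y => g (x + τ • (y - x))) y = _ := h2.fderiv
  rw [pd, h3]; simp [pd]

lemma continuous_homAvg_integrand {f g : (Fin n → ℝ) → ℝ} (hf : Continuous f)
    (hg : Continuous g) (x : Fin n → ℝ) (τ : ℝ) :
    Continuous fun y => f y * g (x + τ • (y - x)) := by fun_prop

lemma integrable_homAvg_integrand {f g : (Fin n → ℝ) → ℝ} (hf : Continuous f)
    (hg : Continuous g) {K : Set (Fin n → ℝ)} (hK : IsCompact K)
    (hfK : ∀ y, y ∉ K → f y = 0) (x : Fin n → ℝ) (τ : ℝ) :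
    Integrable fun y => f y * g (x + τ • (y - x)) :=
  (continuous_homAvg_integrand hf hg x τ).integrable_of_hasCompactSupport
    (HasCompactSupport.intro hK fun y hy => by simp [hfK y hy])

lemma homAvg_pd {f g : (Fin n → ℝ) → ℝ} (hf : ContDiff ℝ (⊤ : ℕ∞) f)
    (hg : ContDiff ℝ (⊤ : ℕ∞) g) {K : Set (Fin n → ℝ)} (hK : IsCompact K)
    (hfK : ∀ y, y ∉ K → f y = 0) (x : Fin n → ℝ) (τ : ℝ) (k : Fin n) :
    τ * homAvg f (pd g k) x τ = - homAvg (pd f k) g x τ := by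
  have hc : ContDiff ℝ (⊤ : ℕ∞) fun y => g (x + τ • (y - x)) :=
    hg.comp (by fun_prop)
  have := integral_mul_pd hf hc hK hfK k
  rw [homAvg, homAvg, ← integral_const_mul, ← this]
  refine integral_congr_ae (Filter.Eventually.of_forall fun y => ?_)
  simp only [pd_comp_homothety hg]
  ring

lemma hasDerivAt_homAvg {f g : (Fin n → ℝ) → ℝ} (hf : Continuous f)
    (hg : ContDiff ℝ (⊤ : ℕ∞) g) {K : Set (Fin n → ℝ)} (hK : IsCompact K)
    (hfK : ∀ y, y ∉ K → f y = 0) (x : Fin n → ℝ) (τ : ℝ) :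
    HasDerivAt (homAvg f g x)
      (∑ k, homAvg (fun y => f y * (y k - x k)) (pd g k) x τ) τ := by
  have hgd : Continuous (fderiv ℝ g) := hg.continuous_fderiv (by simp)
  have h := hasDerivAt_integral_of_compact
    (F := fun s y => f y * g (x + s • (y - x)))
    (F' := fun s y => f y * fderiv ℝ g (x + s • (y - x)) (y - x)) hK
    (fun s => continuous_homAvg_integrand hf hg.continuous x s)
    (by fun_prop) (fun s y hy => by simp [hfK y hy]) (fun s y hy => by simp [hfK y hy])
    (fun s y => by
      have h1 : HasDerivAt (fun s : ℝ => x + s • (y - x)) (y - x) s := by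
        simpa using ((hasDerivAt_id s).smul_const (y - x)).const_add x
      exact ((hg.differentiable (by simp) (x + s • (y - x))).hasFDerivAt.comp_hasDerivAt s
        h1).const_mul (f y)) τ
  refine HasDerivAt.congr_deriv (f := homAvg f g x) h ?_
  simp only [homAvg]
  symm
  rw [← integral_finsetSum _ fun k _ => integrable_homAvg_integrand
    (f := fun y => f y * (y k - x k)) (hf.mul ((continuous_apply k).sub continuous_const))
    (contDiff_pd hg k).continuous hK
    (fun y hy => by simp [hfK y hy]) x τ]
  refine integral_congr_ae (Filter.Eventually.of_forall fun y => ?_)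
  simp only [fderiv_apply_eq_sum_pd, Pi.sub_apply, Finset.mul_sum]
  exact Finset.sum_congr rfl fun k _ => by ring

end Average

section Pointwise

variable {n : ℕ} {K Ω : Set (Fin n → ℝ)}

lemma exists_forall_abs_homAvg_le {ι : Type*} [Fintype ι]
    {G : ι → (Fin n → ℝ) → (Fin n → ℝ) → ℝ} (hG : ∀ a, IsKernel K (G a)) (hK : IsCompact K)
    (hΩ : Bornology.IsBounded Ω) :
    ∃ C, 0 < C ∧ ∀ a, ∀ x ∈ Ω, ∀ g g' : (Fin n → ℝ) → ℝ, Continuous g → Continuous g' →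
      (∀ z, |g z| ≤ g' z) → ∀ τ : ℝ,
      |homAvg (G a x) g x τ| ≤ C * ∫ y in K, g' (x + τ • (y - x)) := by
  choose c hc0 hc using fun a => (hG a).exists_bound hK hΩ
  refine ⟨1 + ∑ a, c a, by have := Finset.sum_nonneg fun a (_ : a ∈ univ) => (hc0 a).le; linarith,
    fun a x hx g g' hg hg' hgg τ => ?_⟩
  have hcle : c a ≤ 1 + ∑ a, c a := by
    have := Finset.single_le_sum (f := c) (fun a _ => (hc0 a).le) (Finset.mem_univ a)
    linarith
  have h1 : homAvg (G a x) g x τ = ∫ y in K, G a x y * g (x + τ • (y - x)) := by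
    refine (setIntegral_eq_integral_of_forall_compl_eq_zero fun y hy => ?_).symm
    rw [(hG a).2 x y hy, zero_mul]
  rw [h1, ← integral_const_mul, ← Real.norm_eq_abs]
  have hc2 : Continuous fun y : Fin n → ℝ => g' (x + τ • (y - x)) := by fun_prop
  refine norm_integral_le_of_norm_le ((hc2.continuousOn.integrableOn_compact hK).const_mul _)
    (Filter.Eventually.of_forall fun y => ?_)
  rw [Real.norm_eq_abs, abs_mul]
  exact mul_le_mul ((hc a x hx y).trans hcle) (hgg _) (abs_nonneg _)
    ((hc0 a).le.trans hcle)

lemma homAvg_pd_pd {f g : (Fin n → ℝ) → ℝ} (hf : ContDiff ℝ (⊤ : ℕ∞) f)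
    (hg : ContDiff ℝ (⊤ : ℕ∞) g) (hK : IsCompact K)
    (hfK : ∀ y, y ∉ K → f y = 0) (x : Fin n → ℝ) (τ : ℝ) (a b : Fin n) :
    τ ^ 2 * homAvg f (pd (pd g a) b) x τ = homAvg (pd (pd f b) a) g x τ := by
  have h1 := homAvg_pd hf (contDiff_pd hg a) hK hfK x τ b
  have h2 := homAvg_pd (contDiff_pd hf b) hg hK
    (pd_eq_zero_of_notMem hK.isClosed hfK b) x τ a
  linear_combination τ * h1 - h2

lemma homAvg_ltf {f : (Fin n → ℝ) → ℝ} (hf : ContDiff ℝ (⊤ : ℕ∞) f) (hK : IsCompact K)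
    (hfK : ∀ y, y ∉ K → f y = 0) {w : (Fin n → ℝ) → Fin n → ℝ}
    (hw : ∀ j, ContDiff ℝ (⊤ : ℕ∞) (fun x => w x j)) (x : Fin n → ℝ) (τ : ℝ) (i j : Fin n) :
    homAvg f (ltf w i j) x τ =
      (homAvg f (pd (fun y => w y j) i) x τ + homAvg f (pd (fun y => w y i) j) x τ) / 2 -
      (1 / (n : ℝ)) * (∑ k, homAvg f (pd (fun y => w y k) k) x τ) * (if i = j then 1 else 0) := by
  have hI : ∀ p q, Integrable fun y => f y * pd (fun y => w y p) q (x + τ • (y - x)) :=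
    fun p q =>
      integrable_homAvg_integrand hf.continuous (contDiff_pd (hw p) q).continuous hK hfK x τ
  have e : ∀ y, f y * ltf w i j (x + τ • (y - x)) =
      ((1 / 2 : ℝ) * (f y * pd (fun y => w y j) i (x + τ • (y - x))) +
       (1 / 2 : ℝ) * (f y * pd (fun y => w y i) j (x + τ • (y - x)))) -
      ((1 / (n : ℝ)) * (if i = j then 1 else 0)) *
        ∑ k, f y * pd (fun y => w y k) k (x + τ • (y - x)) := by
    intro y
    rw [← Finset.mul_sum]
    simp only [ltf, strain, diver]
    ring
  have hI12 : Integrable fun y =>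
      (1 / 2 : ℝ) * (f y * pd (fun y => w y j) i (x + τ • (y - x))) +
       (1 / 2 : ℝ) * (f y * pd (fun y => w y i) j (x + τ • (y - x))) :=
    ((hI j i).const_mul _).add ((hI i j).const_mul _)
  simp only [homAvg, e]
  rw [integral_sub hI12 ((integrable_finsetSum _ fun k _ => hI k k).const_mul _),
    integral_add ((hI j i).const_mul _) ((hI i j).const_mul _), integral_const_mul,
    integral_const_mul, integral_const_mul, integral_finsetSum _ fun k _ => hI k k]
  ring

/-- The Euclidean length of a vector field. -/
noncomputable def fieldNorm (u : (Fin n → ℝ) → Fin n → ℝ) (x : Fin n → ℝ) : ℝ :=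
  √(∑ i, u x i ^ 2)

/-- The Frobenius norm of the trace-free strain. -/
noncomputable def ltfNorm (u : (Fin n → ℝ) → Fin n → ℝ) (x : Fin n → ℝ) : ℝ :=
  √(∑ i, ∑ j, ltf u i j x ^ 2)

lemma abs_le_fieldNorm (u : (Fin n → ℝ) → Fin n → ℝ) (j : Fin n) (x : Fin n → ℝ) :
    |u x j| ≤ fieldNorm u x :=
  Real.abs_le_sqrt (Finset.single_le_sum (f := fun i => u x i ^ 2)
    (fun _ _ => sq_nonneg _) (Finset.mem_univ j))

lemma abs_ltf_le_ltfNorm (u : (Fin n → ℝ) → Fin n → ℝ) (i j : Fin n) (x : Fin n → ℝ) :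
    |ltf u i j x| ≤ ltfNorm u x :=
  Real.abs_le_sqrt ((Finset.single_le_sum (f := fun j => ltf u i j x ^ 2)
    (fun _ _ => sq_nonneg _) (Finset.mem_univ j)).trans
    (Finset.single_le_sum (f := fun i => ∑ j, ltf u i j x ^ 2)
    (fun _ _ => Finset.sum_nonneg fun _ _ => sq_nonneg _) (Finset.mem_univ i)))

lemma continuous_fieldNorm {u : (Fin n → ℝ) → Fin n → ℝ}
    (hu : ∀ j, ContDiff ℝ (⊤ : ℕ∞) (fun x => u x j)) : Continuous (fieldNorm u) :=
  (continuous_finsetSum _ fun j _ => (hu j).continuous.pow 2).sqrt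

lemma continuous_ltfNorm {u : (Fin n → ℝ) → Fin n → ℝ}
    (hu : ∀ j, ContDiff ℝ (⊤ : ℕ∞) (fun x => u x j)) : Continuous (ltfNorm u) :=
  (continuous_finsetSum _ fun i _ => continuous_finsetSum _ fun j _ =>
    (contDiff_ltf hu i j).continuous.pow 2).sqrt

/-- Averages of third derivatives are controlled by averages of the trace-free strain. -/
lemma exists_abs_homAvg_pd_pd_pd_le (hn : 3 ≤ n) {ι : Type*} [Fintype ι]
    {G : ι → (Fin n → ℝ) → (Fin n → ℝ) → ℝ} (hG : ∀ a, IsKernel K (G a))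
    (hK : IsCompact K) (hΩ : Bornology.IsBounded Ω) :
    ∃ C, 0 < C ∧ ∀ u : (Fin n → ℝ) → Fin n → ℝ,
      (∀ j, ContDiff ℝ (⊤ : ℕ∞) (fun x => u x j)) → ∀ s, ∀ x ∈ Ω, ∀ τ : ℝ, 0 < τ →
      ∀ i j k m, |homAvg (G s x) (pd (pd (pd (fun y => u y j) i) k) m) x τ| ≤
        C * (τ ^ 2)⁻¹ * ∫ y in K, ltfNorm u (x + τ • (y - x)) := by
  obtain ⟨C, hC0, hC⟩ := exists_forall_abs_homAvg_le (ι := ι × Fin n × Fin n)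
    (G := fun p x => pd (pd (G p.1 x) p.2.1) p.2.2)
    (fun p => ((hG p.1).pd_right hK.isClosed p.2.1).pd_right hK.isClosed p.2.2) hK hΩ
  refine ⟨21 * C, by positivity, fun u hu s x hx τ hτ i j k m => ?_⟩
  have hsm := (hG s).contDiff_right x
  have h0 := (hG s).2 x
  have key := abs_le_of_traceFree_le hn
    (fun p q r l => homAvg (G s x) (pd (pd (pd (fun y => u y l) q) r) p) x τ)
    (fun a b c l => by
      rw [pd_comm (hu l) b c, pd_comm (contDiff_pd (hu l) c) b a, pd_comm (hu l) c a])
    (fun a b c l => by rw [pd_comm (hu l) b c])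
    (C * (τ ^ 2)⁻¹ * ∫ y in K, ltfNorm u (x + τ • (y - x)))
    (fun p q a b => ?_) m i k j
  · linarith
  have hu1 : ∀ l, ContDiff ℝ (⊤ : ℕ∞) (fun x => pd (fun y => u y l) a x) :=
    fun l => contDiff_pd (hu l) a
  have hu2 : ∀ l, ContDiff ℝ (⊤ : ℕ∞) (fun x => pd (fun y => pd (fun y => u y l) a y) b x) :=
    fun l => contDiff_pd (hu1 l) b
  have h1 := homAvg_ltf hsm hK h0 hu2 x τ p q
  rw [← pd_ltf hu1 p q b, ← pd_ltf hu p q a] at h1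
  have h2 := homAvg_pd_pd hsm (contDiff_ltf hu p q) hK h0 x τ a b
  have h3 := hC (s, b, a) x hx (ltf u p q) (ltfNorm u) (contDiff_ltf hu p q).continuous
    (continuous_ltfNorm hu) (abs_ltf_le_ltfNorm u p q) τ
  simp only at h3
  refine le_trans (le_of_eq ?_) (?_ : |homAvg (G s x) (pd (pd (ltf u p q) a) b) x τ| ≤ _)
  · rw [h1]
  · have h4 : homAvg (G s x) (pd (pd (ltf u p q) a) b) x τ =
        (τ ^ 2)⁻¹ * homAvg (pd (pd (G s x) b) a) (ltf u p q) x τ := by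
      rw [← h2]; field_simp
    rw [h4, abs_mul, abs_of_pos (by positivity)]
    calc _ ≤ (τ ^ 2)⁻¹ * _ := mul_le_mul_of_nonneg_left h3 (by positivity)
      _ = _ := by ring

/-- Taylor expansion to second order with integral remainder. -/
lemma abs_le_of_taylor_two {h h1 h2 : ℝ → ℝ} (hd : ∀ s, HasDerivAt h (h1 s) s)
    (hd1 : ∀ s, HasDerivAt h1 (h2 s) s) (hc : Continuous h2) {t b : ℝ} (ht : 0 < t) (htb : t ≤ b)
    {B : ℝ → ℝ} (hB : ContinuousOn B (Set.Icc t b))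
    (hle : ∀ s ∈ Set.Icc t b, s * |h2 s| ≤ B s) :
    |h t| ≤ |h b| + b * |h1 b| + ∫ s in t..b, B s := by
  have hD : ∀ s ∈ Set.uIcc t b, HasDerivAt (fun s => h s - (s - t) * h1 s)
      (-((s - t) * h2 s)) s := by
    intro s _
    refine ((hd s).sub (((hasDerivAt_id s).sub_const t).mul (hd1 s))).congr_deriv ?_
    simp
  have hcc : Continuous fun s => -((s - t) * h2 s) := by fun_prop
  have hF := intervalIntegral.integral_eq_sub_of_hasDerivAt hD (hcc.intervalIntegrable _ _)
  have hb : |∫ s in t..b, -((s - t) * h2 s)| ≤ ∫ s in t..b, B s := by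
    rw [← Real.norm_eq_abs]
    refine intervalIntegral.norm_integral_le_of_norm_le htb
      (Filter.Eventually.of_forall fun s hs => ?_) (hB.intervalIntegrable_of_Icc htb)
    have := hle s ⟨hs.1.le, hs.2⟩
    rw [norm_neg, Real.norm_eq_abs, abs_mul, abs_of_pos (sub_pos.2 hs.1)]
    refine le_trans (mul_le_mul_of_nonneg_right ?_ (abs_nonneg _)) this
    linarith
  have e : h t = h b - (b - t) * h1 b - ∫ s in t..b, -((s - t) * h2 s) := by
    rw [hF]; ring
  have h3 : |(b - t) * h1 b| ≤ b * |h1 b| := by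
    rw [abs_mul, abs_of_nonneg (by linarith)]
    exact mul_le_mul_of_nonneg_right (by linarith) (abs_nonneg _)
  rw [e]
  calc _ ≤ |h b - (b - t) * h1 b| + |∫ s in t..b, -((s - t) * h2 s)| := abs_sub _ _
    _ ≤ |h b| + |(b - t) * h1 b| + _ := by gcongr; exact abs_sub _ _
    _ ≤ _ := by gcongr

/-- Averages of `∂u` at scale `t` are controlled by `u` at unit scale and by the trace-free strain
at all scales between `t` and `1/2`. -/
lemma exists_abs_homAvg_pd_le (hn : 3 ≤ n)
    {G : (Fin n → ℝ) → (Fin n → ℝ) → ℝ} (hG : IsKernel K G)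
    (hK : IsCompact K) (hΩ : Bornology.IsBounded Ω) :
    ∃ C, 0 < C ∧ ∀ u : (Fin n → ℝ) → Fin n → ℝ,
      (∀ j, ContDiff ℝ (⊤ : ℕ∞) (fun x => u x j)) → ∀ x ∈ Ω, ∀ t : ℝ, 0 < t → t ≤ 1 / 2 →
      ∀ i j, |homAvg (G x) (pd (fun y => u y j) i) x t| ≤
        C * ((∫ y in K, fieldNorm u (x + (1 / 2 : ℝ) • (y - x))) +
          ∫ τ in t..(1 / 2), τ⁻¹ * ∫ y in K, ltfNorm u (x + τ • (y - x))) := by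
  obtain ⟨C1, hC10, hC1⟩ := exists_forall_abs_homAvg_le (ι := Fin n)
    (G := fun i x => pd (G x) i) (fun i => hG.pd_right hK.isClosed i) hK hΩ
  obtain ⟨C2, hC20, hC2⟩ := exists_forall_abs_homAvg_le (ι := Fin n × Fin n)
    (G := fun p x => pd (pd (fun y => G x y * (y p.1 - x p.1)) p.1) p.2)
    (fun p => ((hG.mul_sub p.1).pd_right hK.isClosed p.1).pd_right hK.isClosed p.2) hK hΩ
  obtain ⟨C3, hC30, hC3⟩ := exists_abs_homAvg_pd_pd_pd_le hn (ι := Fin n × Fin n)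
    (G := fun p x y => G x y * (y p.1 - x p.1) * (y p.2 - x p.2))
    (fun p => (hG.mul_sub p.1).mul_sub p.2) hK hΩ
  refine ⟨2 * C1 + 2 * n * C2 + n * n * C3, by positivity, fun u hu x hx t ht ht2 i j => ?_⟩
  have hf := contDiff_pd (hu j) i
  have hGs := hG.contDiff_right x
  have hG1 := fun k => (hG.mul_sub k).contDiff_right x
  have hG2 := fun k m => ((hG.mul_sub k).mul_sub m).contDiff_right x
  set A := ∫ y in K, fieldNorm u (x + (1 / 2 : ℝ) • (y - x)) with hA
  have hA0 : 0 ≤ A := integral_nonneg fun y => Real.sqrt_nonneg _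
  set L : ℝ → ℝ := fun τ => ∫ y in K, ltfNorm u (x + τ • (y - x)) with hL
  have hL0 : ∀ τ, 0 ≤ L τ := fun τ => integral_nonneg fun y => Real.sqrt_nonneg _
  have hLc : Continuous L := by
    have := continuous_ltfNorm hu
    exact continuous_parametric_integral_of_continuous (by fun_prop) hK
  have hd := hasDerivAt_homAvg hGs.continuous hf hK (hG.2 x) x
  have hd1 : ∀ s, HasDerivAt
      (fun s => ∑ k, homAvg (fun y => G x y * (y k - x k)) (pd (pd (fun y => u y j) i) k) x s)
      (∑ k, ∑ m, homAvg (fun y => G x y * (y k - x k) * (y m - x m))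
        (pd (pd (pd (fun y => u y j) i) k) m) x s) s := fun s =>
    HasDerivAt.fun_sum fun k _ => hasDerivAt_homAvg (hG1 k).continuous (contDiff_pd hf k) hK
      ((hG.mul_sub k).2 x) x s
  have hc2 : Continuous fun s => ∑ k, ∑ m, homAvg (fun y => G x y * (y k - x k) * (y m - x m))
        (pd (pd (pd (fun y => u y j) i) k) m) x s :=
    continuous_finsetSum _ fun k _ => continuous_finsetSum _ fun m _ =>
      continuous_iff_continuousAt.2 fun s => (hasDerivAt_homAvg (hG2 k m).continuous
        (contDiff_pd (contDiff_pd hf k) m) hK (((hG.mul_sub k).mul_sub m).2 x) x s).continuousAt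
  have hpos : ∀ s ∈ Set.Icc t (1 / 2), s ≠ 0 := fun s hs => (ht.trans_le hs.1).ne'
  have hB : ContinuousOn (fun s => n * n * C3 * (s⁻¹ * L s)) (Set.Icc t (1 / 2)) :=
    continuousOn_const.mul ((continuousOn_inv₀.mono fun s hs => hpos s hs).mul hLc.continuousOn)
  have hT := abs_le_of_taylor_two hd hd1 hc2 ht ht2 hB (fun s hs => by
    have hs0 : 0 < s := ht.trans_le hs.1
    calc _ ≤ s * ∑ k : Fin n, ∑ m : Fin n, C3 * (s ^ 2)⁻¹ * L s := by
          gcongr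
          refine (Finset.abs_sum_le_sum_abs _ _).trans (Finset.sum_le_sum fun k _ =>
            (Finset.abs_sum_le_sum_abs _ _).trans (Finset.sum_le_sum fun m _ => ?_))
          exact hC3 u hu (k, m) x hx s hs0 i j k m
      _ = _ := by
          simp only [Finset.sum_const, Finset.card_univ, Fintype.card_fin, nsmul_eq_mul]
          field_simp)
  have e0 : |homAvg (G x) (pd (fun y => u y j) i) x (1 / 2)| ≤ 2 * C1 * A := by
    have h1 := homAvg_pd hGs (hu j) hK (hG.2 x) x (1 / 2) i
    have h2 := hC1 i x hx (fun y => u y j) (fieldNorm u) (hu j).continuous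
      (continuous_fieldNorm hu) (abs_le_fieldNorm u j) (1 / 2)
    have h3 : homAvg (G x) (pd (fun y => u y j) i) x (1 / 2) =
      -2 * homAvg (pd (G x) i) (fun y => u y j) x (1 / 2) := by linarith
    rw [h3, abs_mul]
    norm_num at h2 ⊢
    linarith
  have e1 : |∑ k, homAvg (fun y => G x y * (y k - x k)) (pd (pd (fun y => u y j) i) k) x (1 / 2)|
      ≤ 4 * n * C2 * A := by
    calc _ ≤ ∑ k : Fin n, 4 * C2 * A := by
          refine (Finset.abs_sum_le_sum_abs _ _).trans (Finset.sum_le_sum fun k _ => ?_)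
          have h1 := homAvg_pd_pd (hG1 k) (hu j) hK ((hG.mul_sub k).2 x) x (1 / 2) i k
          have h2 := hC2 (k, i) x hx (fun y => u y j) (fieldNorm u) (hu j).continuous
            (continuous_fieldNorm hu) (abs_le_fieldNorm u j) (1 / 2)
          have h3 : homAvg (fun y => G x y * (y k - x k)) (pd (pd (fun y => u y j) i) k) x (1 / 2) =
            4 * homAvg (pd (pd (fun y => G x y * (y k - x k)) k) i) (fun y => u y j) x (1 / 2) := by
            linarith
          rw [h3, abs_mul]
          norm_num at h2 ⊢
          linarith
      _ = _ := by
          simp only [Finset.sum_const, Finset.card_univ, Fintype.card_fin, nsmul_eq_mul]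
          ring
  rw [intervalIntegral.integral_const_mul] at hT
  have hR : 0 ≤ ∫ τ in t..(1 / 2), τ⁻¹ * L τ :=
    intervalIntegral.integral_nonneg ht2 fun s hs =>
      mul_nonneg (inv_nonneg.2 (ht.le.trans hs.1)) (hL0 s)
  have hn0 : (0 : ℝ) ≤ n := Nat.cast_nonneg n
  have p1 : 0 ≤ (2 * C1 + 2 * n * C2) * ∫ τ in t..(1 / 2), τ⁻¹ * L τ := by positivity
  have p2 : 0 ≤ n * n * C3 * A := by positivity
  change _ ≤ (2 * C1 + 2 * n * C2 + n * n * C3) * (A + ∫ τ in t..(1 / 2), τ⁻¹ * L τ)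
  linarith

end Pointwise

section WeightedHardy

lemma mul_le_infDist_compl_of_convex {E : Type*} [NormedAddCommGroup E] [NormedSpace ℝ E]
    {Ω : Set E} (hΩ : Convex ℝ Ω) (hne : Ωᶜ.Nonempty) {a y : E} {c s : ℝ} (ha : a ∈ Ω)
    (hy : c ≤ Metric.infDist y Ωᶜ) (hs0 : 0 ≤ s) (hs1 : s ≤ 1) :
    s * c ≤ Metric.infDist ((1 - s) • a + s • y) Ωᶜ := by
  rcases hs0.eq_or_lt with rfl | hs
  · simpa using Metric.infDist_nonneg
  refine (Metric.le_infDist hne).2 fun q hq => ?_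
  by_contra! hlt
  set p := (1 - s) • a + s • y with hp
  have hmem : y + s⁻¹ • (q - p) ∈ Ω := by
    by_contra hn
    have h1 := hy.trans (Metric.infDist_le_dist_of_mem (x := y) hn)
    rw [dist_eq_norm, sub_add_cancel_left, norm_neg, norm_smul, Real.norm_of_nonneg
      (by positivity), ← dist_eq_norm, dist_comm] at h1
    have : s * c ≤ dist p q := by
      calc s * c ≤ s * (s⁻¹ * dist p q) := by gcongr
        _ = dist p q := by field_simp
    linarith
  apply hq
  have := hΩ ha hmem (by linarith : 0 ≤ 1 - s) hs0 (by ring)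
  convert this using 1
  rw [smul_add, smul_inv_smul₀ hs.ne', ← add_assoc, ← hp]
  abel

lemma lintegral_rpow_neg_half_Ioo {m : ℝ} (hm : 0 < m) :
    ∫⁻ τ in Set.Ioo 0 m, ENNReal.ofReal (τ ^ (-(1 / 2) : ℝ)) =
      ENNReal.ofReal (2 * m ^ (1 / 2 : ℝ)) := by
  have hi : IntervalIntegrable (fun τ : ℝ => τ ^ (-(1 / 2) : ℝ)) volume 0 m :=
    intervalIntegral.intervalIntegrable_rpow' (by norm_num)
  rw [intervalIntegrable_iff_integrableOn_Ioo_of_le hm.le] at hi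
  rw [← ofReal_integral_eq_lintegral_ofReal hi]
  · rw [← integral_Ioc_eq_integral_Ioo, ← intervalIntegral.integral_of_le hm.le,
      integral_rpow (Or.inl (by norm_num))]
    congr 1
    norm_num
    ring
  · filter_upwards [ae_restrict_mem measurableSet_Ioo] with τ hτ
    exact Real.rpow_nonneg hτ.1.le _

lemma lintegral_rpow_neg_half_sub_Ioo {m : ℝ} (hm : 0 < m) :
    ∫⁻ τ in Set.Ioo 0 m, ENNReal.ofReal ((m - τ) ^ (-(1 / 2) : ℝ)) =
      ENNReal.ofReal (2 * m ^ (1 / 2 : ℝ)) := by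
  rw [← lintegral_rpow_neg_half_Ioo hm]
  rw [← lintegral_indicator measurableSet_Ioo, ← lintegral_indicator measurableSet_Ioo,
    ← lintegral_sub_left_eq_self _ m]
  congr 1
  ext τ
  by_cases h : τ ∈ Set.Ioo 0 m
  · have h' : m - τ ∈ Set.Ioo 0 m := ⟨by linarith [h.2], by linarith [h.1]⟩
    simp [h, h']
  · have h' : m - τ ∉ Set.Ioo 0 m := fun h' => h ⟨by linarith [h'.2], by linarith [h'.1]⟩
    simp [h, h']

lemma lintegral_beta_half_le {m : ℝ} (hm : 0 < m) :
    ∫⁻ τ in Set.Ioo 0 m, ENNReal.ofReal (τ ^ (-(1 / 2) : ℝ)) *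
      ENNReal.ofReal ((m - τ) ^ (-(1 / 2) : ℝ)) ≤ 8 := by
  have hpt : ∀ τ ∈ Set.Ioo 0 m, ENNReal.ofReal (τ ^ (-(1 / 2) : ℝ)) *
      ENNReal.ofReal ((m - τ) ^ (-(1 / 2) : ℝ)) ≤
      ENNReal.ofReal ((m / 2) ^ (-(1 / 2) : ℝ)) * (ENNReal.ofReal (τ ^ (-(1 / 2) : ℝ)) +
        ENNReal.ofReal ((m - τ) ^ (-(1 / 2) : ℝ))) := by
    intro τ hτ
    rcases le_total τ (m / 2) with h | h
    · rw [mul_comm, mul_add]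
      refine le_add_right ?_
      exact mul_le_mul' (ENNReal.ofReal_le_ofReal (Real.rpow_le_rpow_of_nonpos
        (by linarith [hm, hτ.1]) (by linarith) (by norm_num))) le_rfl
    · rw [mul_add]
      refine le_add_left ?_
      exact mul_le_mul' (ENNReal.ofReal_le_ofReal (Real.rpow_le_rpow_of_nonpos
        (by linarith [hm, hτ.1]) (by linarith) (by norm_num))) le_rfl
  refine (setLIntegral_mono (by fun_prop) hpt).trans ?_
  rw [lintegral_const_mul _ (by fun_prop), lintegral_add_left (by fun_prop),
    lintegral_rpow_neg_half_Ioo hm, lintegral_rpow_neg_half_sub_Ioo hm,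
    ← ENNReal.ofReal_add (by positivity) (by positivity), ← ENNReal.ofReal_mul (by positivity)]
  rw [← ENNReal.ofReal_ofNat 8]
  apply ENNReal.ofReal_le_ofReal
  have h1 : (m / 2) ^ (-(1 / 2) : ℝ) = m ^ (-(1 / 2) : ℝ) * 2 ^ (1 / 2 : ℝ) := by
    rw [Real.div_rpow hm.le (by norm_num), Real.rpow_neg (by norm_num : (0 : ℝ) ≤ 2)]
    simp
  have h2 : m ^ (-(1 / 2) : ℝ) * m ^ (1 / 2 : ℝ) = 1 := by
    rw [← Real.rpow_add hm]; simp
  have h3 : (2 : ℝ) ^ (1 / 2 : ℝ) ≤ 2 := by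
    calc (2 : ℝ) ^ (1 / 2 : ℝ) ≤ 2 ^ (1 : ℝ) :=
          Real.rpow_le_rpow_of_exponent_le (by norm_num) (by norm_num)
      _ = 2 := by simp
  rw [h1]
  nlinarith [h2, h3, mul_comm (m ^ (-(1 / 2) : ℝ)) (m ^ (1 / 2 : ℝ))]

lemma setLIntegral_rpow_mul_le {c : ℝ} (hc : 0 < c) {T : Set ℝ}
    (hT : T ⊆ Set.Ioc 0 (1 / 2)) {w : ℝ → ENNReal} {d : ℝ → ℝ} (hw0 : ∀ τ, τ ∉ T → w τ = 0)
    (hw : ∀ τ ∈ T, w τ ≤ ENNReal.ofReal (d τ ^ (-(1 / 2) : ℝ)))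
    (hd : ∀ τ ∈ T, ∀ τ' ∈ T, τ < τ' → c * (τ' - τ) ≤ d τ) :
    ∫⁻ τ in Set.Ioc 0 (1 / 2 : ℝ), ENNReal.ofReal (τ ^ (-(1 / 2) : ℝ)) * w τ ≤
      8 * ENNReal.ofReal (c ^ (-(1 / 2) : ℝ)) := by
  rcases T.eq_empty_or_nonempty with rfl | ⟨τ₀, hτ₀⟩
  · simp [hw0]
  have hbdd : BddAbove T := ⟨1 / 2, fun τ h => (hT h).2⟩
  set m := sSup T with hm
  have hm0 : 0 < m := (hT hτ₀).1.trans_le (le_csSup hbdd hτ₀)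
  have hpt : ∀ᵐ τ ∂(volume : Measure ℝ), (Set.Ioc 0 (1 / 2 : ℝ)).indicator
      (fun τ => ENNReal.ofReal (τ ^ (-(1 / 2) : ℝ)) * w τ) τ ≤
      (Set.Ioo 0 m).indicator (fun τ => (ENNReal.ofReal (τ ^ (-(1 / 2) : ℝ)) *
        ENNReal.ofReal ((m - τ) ^ (-(1 / 2) : ℝ))) * ENNReal.ofReal (c ^ (-(1 / 2) : ℝ))) τ := by
    have : ∀ᵐ τ ∂(volume : Measure ℝ), τ ≠ m := by
      simp [ae_iff]
    filter_upwards [this] with τ hτm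
    by_cases hτ : τ ∈ T
    · have hlt : τ < m := lt_of_le_of_ne (le_csSup hbdd hτ) hτm
      rw [Set.indicator_of_mem (hT hτ),
        Set.indicator_of_mem (show τ ∈ Set.Ioo 0 m from ⟨(hT hτ).1, hlt⟩)]
      rw [mul_assoc]
      gcongr
      refine (hw τ hτ).trans ?_
      have hle : c * (m - τ) ≤ d τ := by
        have : m ≤ d τ / c + τ := by
          refine csSup_le ⟨τ, hτ⟩ fun τ' hτ' => ?_
          rcases lt_or_ge τ τ' with h | h
          · have := hd τ hτ τ' hτ' h
            rw [← sub_le_iff_le_add, le_div_iff₀ hc]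
            linarith
          · obtain ⟨τ'', hτ'', h''⟩ := exists_lt_of_lt_csSup ⟨τ, hτ⟩ hlt
            have h1 := hd τ hτ τ'' hτ'' h''
            have : 0 ≤ d τ := le_trans (mul_nonneg hc.le (by linarith)) h1
            have : 0 ≤ d τ / c := by positivity
            linarith
        rw [← sub_le_iff_le_add, le_div_iff₀ hc] at this
        linarith
      rw [← ENNReal.ofReal_mul (Real.rpow_nonneg (by linarith) _), mul_comm,
        ← Real.mul_rpow hc.le (by linarith)]
      exact ENNReal.ofReal_le_ofReal (Real.rpow_le_rpow_of_nonpos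
        (mul_pos hc (by linarith)) hle (by norm_num))
    · have : (Set.Ioc 0 (1 / 2 : ℝ)).indicator
        (fun τ => ENNReal.ofReal (τ ^ (-(1 / 2) : ℝ)) * w τ) τ = 0 := by
        simp [Set.indicator, hw0 τ hτ]
      rw [this]
      exact zero_le
  rw [← lintegral_indicator measurableSet_Ioc]
  refine (lintegral_mono_ae hpt).trans ?_
  rw [lintegral_indicator measurableSet_Ioo, lintegral_mul_const _ (by fun_prop)]
  gcongr
  exact lintegral_beta_half_le hm0

variable {n : ℕ}

lemma lintegral_homothety_le {φ : (Fin n → ℝ) → ENNReal} (y : Fin n → ℝ)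
    {τ : ℝ} (hτ : τ ≤ 1 / 2) :
    ∫⁻ x, φ (x + τ • (y - x)) ≤ 2 ^ n * ∫⁻ z, φ z := by
  have h1 : ∀ x : Fin n → ℝ, x + τ • (y - x) = (1 - τ) • x + τ • y := fun x => by
    rw [smul_sub, sub_smul, one_smul]; abel
  have hne : (1 - τ) ≠ 0 := by linarith
  simp_rw [h1]
  have h2 : ∫⁻ x, φ ((1 - τ) • x + τ • y) =
      ∫⁻ z, φ (z + τ • y) ∂(Measure.map (fun x : Fin n → ℝ => (1 - τ) • x) volume) := by
    exact ((Homeomorph.smulOfNeZero (α := Fin n → ℝ) (1 - τ)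
      hne).measurableEmbedding.lintegral_map (fun z => φ (z + τ • y))).symm
  rw [h2, show (fun x : Fin n → ℝ => (1 - τ) • x) = ((1 - τ) • ·) from rfl,
    Measure.map_addHaar_smul _ hne, lintegral_smul_measure, lintegral_add_right_eq_self,
    smul_eq_mul]
  gcongr
  have : (1 : ℝ) / 2 ≤ 1 - τ := by linarith
  rw [abs_of_pos (by positivity), Module.finrank_fin_fun]
  calc ENNReal.ofReal ((1 - τ) ^ n)⁻¹ ≤ ENNReal.ofReal (2 ^ n) := by
        apply ENNReal.ofReal_le_ofReal
        rw [← inv_pow]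
        gcongr
        rw [inv_le_comm₀ (by linarith) (by norm_num)]
        linarith
    _ = 2 ^ n := by rw [ENNReal.ofReal_pow (by norm_num)]; simp

lemma lintegral_weighted_hardy {Ω K : Set (Fin n → ℝ)} (hΩ : Convex ℝ Ω) (ho : IsOpen Ω)
    (hne : Ωᶜ.Nonempty) {c : ℝ} (hc : 0 < c) (hKm : MeasurableSet K)
    (hK : ∀ y ∈ K, c ≤ Metric.infDist y Ωᶜ) {g : (Fin n → ℝ) → ENNReal} (hg : Measurable g) :
    ∫⁻ x in Ω, ENNReal.ofReal (Metric.infDist x Ωᶜ ^ (-(1 / 2) : ℝ)) *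
        ∫⁻ τ in Set.Ioc 0 (1 / 2 : ℝ), ENNReal.ofReal (τ ^ (-(1 / 2) : ℝ)) *
          ∫⁻ y in K, g (x + τ • (y - x)) ≤
      volume K * (2 ^ n * (8 * ENNReal.ofReal (c ^ (-(1 / 2) : ℝ)))) * ∫⁻ z, g z := by
  set W : (Fin n → ℝ) → ENNReal :=
    Ω.indicator fun x => ENNReal.ofReal (Metric.infDist x Ωᶜ ^ (-(1 / 2) : ℝ)) with hW
  have hWm : Measurable W := by
    refine Measurable.indicator ?_ ho.measurableSet
    have : Measurable fun x : Fin n → ℝ => Metric.infDist x Ωᶜ :=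
      (Metric.continuous_infDist_pt _).measurable
    fun_prop
  have hstart : ∫⁻ x in Ω, ENNReal.ofReal (Metric.infDist x Ωᶜ ^ (-(1 / 2) : ℝ)) *
        ∫⁻ τ in Set.Ioc 0 (1 / 2 : ℝ), ENNReal.ofReal (τ ^ (-(1 / 2) : ℝ)) *
          ∫⁻ y in K, g (x + τ • (y - x)) =
      ∫⁻ x, ∫⁻ τ in Set.Ioc 0 (1 / 2 : ℝ), ∫⁻ y in K,
        W x * (ENNReal.ofReal (τ ^ (-(1 / 2) : ℝ)) * g (x + τ • (y - x))) := by
    rw [← lintegral_indicator ho.measurableSet]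
    congr 1
    ext x
    have e1 : ∀ τ : ℝ, ∫⁻ y in K, W x * (ENNReal.ofReal (τ ^ (-(1 / 2) : ℝ)) *
        g (x + τ • (y - x))) = W x * (ENNReal.ofReal (τ ^ (-(1 / 2) : ℝ)) *
          ∫⁻ y in K, g (x + τ • (y - x))) := fun τ => by
      rw [lintegral_const_mul _ (by fun_prop), lintegral_const_mul _ (by fun_prop)]
    simp_rw [e1]
    rw [lintegral_const_mul]
    · by_cases hx : x ∈ Ω <;> simp [hW, hx]
    · refine Measurable.mul (by fun_prop) ?_
      refine Measurable.lintegral_prod_right' (f := fun p : ℝ × (Fin n → ℝ) =>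
        g (x + p.1 • (p.2 - x))) ?_
      fun_prop
  have hF : Measurable fun q : ((Fin n → ℝ) × ℝ) × (Fin n → ℝ) =>
      W q.1.1 * (ENNReal.ofReal (q.1.2 ^ (-(1 / 2) : ℝ)) * g (q.1.1 + q.1.2 • (q.2 - q.1.1))) := by
    fun_prop
  have hF' : Measurable fun q : ((Fin n → ℝ) × ℝ) × (Fin n → ℝ) =>
      W ((1 - q.1.2)⁻¹ • (q.2 - q.1.2 • q.1.1)) *
        (ENNReal.ofReal (q.1.2 ^ (-(1 / 2) : ℝ)) * g q.2) := by
    have hm : Measurable fun q : ((Fin n → ℝ) × ℝ) × (Fin n → ℝ) =>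
        (1 - q.1.2)⁻¹ • (q.2 - q.1.2 • q.1.1) := by
      have h1 : Measurable fun q : ((Fin n → ℝ) × ℝ) × (Fin n → ℝ) => (1 - q.1.2)⁻¹ := by
        fun_prop
      exact h1.smul (by fun_prop)
    exact (hWm.comp hm).mul (by fun_prop)
  calc _ = ∫⁻ x, ∫⁻ τ in Set.Ioc 0 (1 / 2 : ℝ), ∫⁻ y in K,
        W x * (ENNReal.ofReal (τ ^ (-(1 / 2) : ℝ)) * g (x + τ • (y - x))) := hstart
    _ = ∫⁻ τ in Set.Ioc 0 (1 / 2 : ℝ), ∫⁻ y in K, ∫⁻ x,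
        W x * (ENNReal.ofReal (τ ^ (-(1 / 2) : ℝ)) * g (x + τ • (y - x))) := by
      rw [lintegral_lintegral_swap]
      · refine lintegral_congr fun τ => ?_
        rw [lintegral_lintegral_swap]
        refine (Measurable.aemeasurable ?_)
        exact hF.comp (show Measurable fun p : (Fin n → ℝ) × (Fin n → ℝ) => ((p.1, τ), p.2) by
          fun_prop)
      · exact (Measurable.lintegral_prod_right' hF).aemeasurable
    _ ≤ ∫⁻ τ in Set.Ioc 0 (1 / 2 : ℝ), ∫⁻ y in K, 2 ^ n * ∫⁻ z,
        W ((1 - τ)⁻¹ • (z - τ • y)) * (ENNReal.ofReal (τ ^ (-(1 / 2) : ℝ)) * g z) := by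
      refine setLIntegral_mono' measurableSet_Ioc fun τ hτ => lintegral_mono fun y => ?_
      refine le_trans (le_of_eq ?_) (lintegral_homothety_le y hτ.2)
      refine lintegral_congr fun x => ?_
      have hne : (1 - τ) ≠ 0 := by linarith [hτ.2]
      have : (1 - τ)⁻¹ • (x + τ • (y - x) - τ • y) = x := by
        rw [inv_smul_eq_iff₀ hne, smul_sub, sub_smul, one_smul]
        abel
      rw [this]
    _ = ∫⁻ y in K, 2 ^ n * ∫⁻ z, ∫⁻ τ in Set.Ioc 0 (1 / 2 : ℝ),
        W ((1 - τ)⁻¹ • (z - τ • y)) * (ENNReal.ofReal (τ ^ (-(1 / 2) : ℝ)) * g z) := by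
      have hsw := (Measurable.lintegral_prod_right' (ν := volume) hF').comp
        (measurable_swap (α := ℝ) (β := Fin n → ℝ))
      rw [lintegral_lintegral_swap]
      · refine lintegral_congr fun y => ?_
        rw [lintegral_const_mul, lintegral_lintegral_swap]
        · refine (Measurable.aemeasurable ?_)
          exact hF'.comp (show Measurable fun p : ℝ × (Fin n → ℝ) => ((y, p.1), p.2) by
            fun_prop)
        · exact hsw.comp (show Measurable fun τ : ℝ => (τ, y) by fun_prop)
      · exact (hsw.const_mul _).aemeasurable
    _ ≤ ∫⁻ y in K, 2 ^ n * ∫⁻ z, 8 * ENNReal.ofReal (c ^ (-(1 / 2) : ℝ)) * g z := by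
      refine setLIntegral_mono' hKm fun y hy => ?_
      gcongr with z
      have e : ∫⁻ τ in Set.Ioc 0 (1 / 2 : ℝ), W ((1 - τ)⁻¹ • (z - τ • y)) *
          (ENNReal.ofReal (τ ^ (-(1 / 2) : ℝ)) * g z) =
          (∫⁻ τ in Set.Ioc 0 (1 / 2 : ℝ), ENNReal.ofReal (τ ^ (-(1 / 2) : ℝ)) *
            W ((1 - τ)⁻¹ • (z - τ • y))) * g z := by
        rw [← lintegral_mul_const]
        · refine lintegral_congr fun τ => ?_
          ring
        · have hm : Measurable fun τ : ℝ => (1 - τ)⁻¹ • (z - τ • y) := by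
            have h1 : Measurable fun τ : ℝ => (1 - τ)⁻¹ := by fun_prop
            exact h1.smul (by fun_prop)
          exact Measurable.mul (by fun_prop) (hWm.comp hm)
      rw [e]
      gcongr
      set p : ℝ → (Fin n → ℝ) := fun τ => (1 - τ)⁻¹ • (z - τ • y) with hp
      have hind : ∀ τ ∈ Set.Ioc 0 (1 / 2 : ℝ), W (p τ) =
          (Set.Ioc 0 (1 / 2 : ℝ)).indicator (fun τ => W (p τ)) τ := fun τ hτ => by
        rw [Set.indicator_of_mem hτ]
      rw [setLIntegral_congr_fun measurableSet_Ioc (g := fun τ =>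
        ENNReal.ofReal (τ ^ (-(1 / 2) : ℝ)) *
          (Set.Ioc 0 (1 / 2 : ℝ)).indicator (fun τ => W (p τ)) τ)
        (fun τ hτ => congrArg (_ * ·) (hind τ hτ))]
      refine setLIntegral_rpow_mul_le hc (T := {τ | τ ∈ Set.Ioc 0 (1 / 2 : ℝ) ∧ p τ ∈ Ω})
        (d := fun τ => Metric.infDist (p τ) Ωᶜ) (fun τ hτ => hτ.1) ?_ ?_ ?_
      · intro τ hτ
        by_cases h : τ ∈ Set.Ioc 0 (1 / 2 : ℝ)
        · have h' : p τ ∉ Ω := fun h' => hτ ⟨h, h'⟩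
          simp [hW, h']
        · rw [Set.indicator_of_notMem h]
      · intro τ hτ
        rw [Set.indicator_of_mem hτ.1, hW, Set.indicator_of_mem hτ.2]
      · intro τ hτ τ' hτ' hlt
        have h1 : 0 < 1 - τ := by linarith [hτ.1.2]
        have h2 : 0 < 1 - τ' := by linarith [hτ'.1.2]
        have h3 := hτ.1.1
        set s := (τ' - τ) / (1 - τ) with hs
        have hs0 : 0 ≤ s := div_nonneg (by linarith) h1.le
        have hs1 : s ≤ 1 := by
          rw [hs, div_le_one h1]
          linarith
        have key := mul_le_infDist_compl_of_convex hΩ hne hτ'.2 (hK y hy) hs0 hs1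
        have hpt : (1 - s) • p τ' + s • y = p τ := by
          ext i
          simp only [hs, hp, Pi.add_apply, Pi.smul_apply, Pi.sub_apply, smul_eq_mul]
          field_simp
          ring
        rw [hpt] at key
        refine le_trans ?_ key
        rw [mul_comm]
        gcongr
        rw [hs, le_div_iff₀ h1]
        nlinarith
    _ = _ := by
      rw [setLIntegral_const, lintegral_const_mul _ hg]
      ring

end WeightedHardy

section WeightedHardyReal

lemma sq_lintegral_mul_le {α : Type*} [MeasurableSpace α] (μ : Measure α) {f g : α → ENNReal}
    (hf : AEMeasurable f μ) (hg : AEMeasurable g μ) :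
    (∫⁻ a, f a * g a ∂μ) ^ 2 ≤ (∫⁻ a, f a ^ 2 ∂μ) * ∫⁻ a, g a ^ 2 ∂μ := by
  have h := ENNReal.lintegral_mul_le_Lp_mul_Lq μ Real.HolderConjugate.two_two hf hg
  calc _ ≤ ((∫⁻ a, f a ^ (2 : ℝ) ∂μ) ^ (1 / 2 : ℝ) *
        (∫⁻ a, g a ^ (2 : ℝ) ∂μ) ^ (1 / 2 : ℝ)) ^ 2 := by
        gcongr
        exact h
    _ = _ := by
        rw [mul_pow, ← ENNReal.rpow_natCast, ← ENNReal.rpow_natCast, ← ENNReal.rpow_mul,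
          ← ENNReal.rpow_mul]
        simp

lemma sq_setLIntegral_le {α : Type*} [MeasurableSpace α] (μ : Measure α) (s : Set α)
    {g : α → ENNReal} (hg : AEMeasurable g (μ.restrict s)) :
    (∫⁻ a in s, g a ∂μ) ^ 2 ≤ μ s * ∫⁻ a in s, g a ^ 2 ∂μ := by
  simpa using sq_lintegral_mul_le (μ.restrict s) (f := fun _ => 1) aemeasurable_const hg

lemma ofReal_sq_integral_le {α : Type*} [MeasurableSpace α] (μ : Measure α)
    {f : α → ℝ} (hf : AEStronglyMeasurable f μ) (hf0 : 0 ≤ᵐ[μ] f) :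
    ENNReal.ofReal ((∫ a, f a ∂μ) ^ 2) ≤ (∫⁻ a, ENNReal.ofReal (f a) ∂μ) ^ 2 := by
  rw [ENNReal.ofReal_pow (integral_nonneg_of_ae hf0), integral_eq_lintegral_of_nonneg_ae hf0 hf]
  gcongr
  exact ENNReal.ofReal_toReal_le

lemma lintegral_rpow_neg_three_half_le {t b : ℝ} (ht : 0 < t) (htb : t ≤ b) :
    ∫⁻ τ in Set.Ioc t b, ENNReal.ofReal (τ ^ (-(3 / 2) : ℝ)) ≤
      ENNReal.ofReal (2 * t ^ (-(1 / 2) : ℝ)) := by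
  have h0 : (0 : ℝ) ∉ Set.uIcc t b := by
    rw [Set.uIcc_of_le htb]
    exact fun h => absurd h.1 (not_le.2 ht)
  have hi : IntervalIntegrable (fun τ : ℝ => τ ^ (-(3 / 2) : ℝ)) volume t b :=
    intervalIntegral.intervalIntegrable_rpow (Or.inr h0)
  rw [intervalIntegrable_iff_integrableOn_Ioc_of_le htb] at hi
  rw [← ofReal_integral_eq_lintegral_ofReal hi]
  · rw [← intervalIntegral.integral_of_le htb, integral_rpow (Or.inr ⟨by norm_num, h0⟩)]
    apply ENNReal.ofReal_le_ofReal
    have : 0 ≤ b ^ (-(1 / 2) : ℝ) := Real.rpow_nonneg (by linarith) _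
    have e : (-(3 / 2) + 1 : ℝ) = -(1 / 2) := by norm_num
    rw [e]
    linarith
  · filter_upwards [ae_restrict_mem measurableSet_Ioc] with τ hτ
    exact Real.rpow_nonneg (ht.trans hτ.1).le _

variable {n : ℕ}

lemma ofReal_sq_setIntegral_homothety_le {K : Set (Fin n → ℝ)} {f : (Fin n → ℝ) → ℝ}
    (hf : Continuous f) (hf0 : ∀ x, 0 ≤ f x) (x : Fin n → ℝ) (τ : ℝ) :
    ENNReal.ofReal ((∫ y in K, f (x + τ • (y - x))) ^ 2) ≤
      volume K * ∫⁻ y in K, ENNReal.ofReal (f (x + τ • (y - x)) ^ 2) := by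
  refine (ofReal_sq_integral_le _ (by fun_prop)
    (Filter.Eventually.of_forall fun y => hf0 _)).trans ?_
  refine (sq_setLIntegral_le _ _ (by fun_prop)).trans (le_of_eq ?_)
  simp_rw [← ENNReal.ofReal_pow (hf0 _)]

lemma ofReal_sq_integral_inv_mul_le {K : Set (Fin n → ℝ)} (hK : IsCompact K)
    {f : (Fin n → ℝ) → ℝ} (hf : Continuous f) (hf0 : ∀ x, 0 ≤ f x) (x : Fin n → ℝ)
    {t : ℝ} (ht : 0 < t) (ht2 : t ≤ 1 / 2) :
    ENNReal.ofReal ((∫ τ in t..(1 / 2), τ⁻¹ * ∫ y in K, f (x + τ • (y - x))) ^ 2) ≤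
      ENNReal.ofReal (2 * t ^ (-(1 / 2) : ℝ)) * (volume K *
        ∫⁻ τ in Set.Ioc 0 (1 / 2 : ℝ), ENNReal.ofReal (τ ^ (-(1 / 2) : ℝ)) *
          ∫⁻ y in K, ENNReal.ofReal (f (x + τ • (y - x)) ^ 2)) := by
  set B : ℝ → ℝ := fun τ => ∫ y in K, f (x + τ • (y - x)) with hB
  have hBc : Continuous B := by
    have : Continuous (Function.uncurry fun (τ : ℝ) (y : Fin n → ℝ) => f (x + τ • (y - x))) := by
      unfold Function.uncurry
      fun_prop
    exact continuous_parametric_integral_of_continuous this hK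
  have hB0 : ∀ τ, 0 ≤ B τ := fun τ => integral_nonneg fun y => hf0 _
  rw [intervalIntegral.integral_of_le ht2]
  have hBm : AEStronglyMeasurable (fun τ => τ⁻¹ * B τ) (volume.restrict (Set.Ioc t (1 / 2))) := by
    have := hBc.measurable
    exact Measurable.aestronglyMeasurable (by fun_prop)
  refine (ofReal_sq_integral_le _ hBm ?_).trans ?_
  · filter_upwards [ae_restrict_mem measurableSet_Ioc] with τ hτ
    have := ht.trans hτ.1
    exact mul_nonneg (by positivity) (hB0 τ)
  have hsplit : ∫⁻ τ in Set.Ioc t (1 / 2), ENNReal.ofReal (τ⁻¹ * B τ) =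
      ∫⁻ τ in Set.Ioc t (1 / 2), ENNReal.ofReal (τ ^ (-(3 / 4) : ℝ)) *
        ENNReal.ofReal (τ ^ (-(1 / 4) : ℝ) * B τ) := by
    refine setLIntegral_congr_fun measurableSet_Ioc fun τ hτ => ?_
    have h0 := ht.trans hτ.1
    rw [← ENNReal.ofReal_mul (by positivity), ← mul_assoc, ← Real.rpow_add h0]
    norm_num [Real.rpow_neg_one]
  rw [hsplit]
  refine (sq_lintegral_mul_le _ (by fun_prop) (by fun_prop)).trans ?_
  refine mul_le_mul' ?_ ?_
  · refine le_trans (le_of_eq ?_) (lintegral_rpow_neg_three_half_le ht ht2)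
    refine setLIntegral_congr_fun measurableSet_Ioc fun τ hτ => ?_
    have h0 := ht.trans hτ.1
    rw [← ENNReal.ofReal_pow (by positivity), ← Real.rpow_natCast, ← Real.rpow_mul h0.le]
    norm_num
  · rw [← lintegral_const_mul]
    · refine le_trans (setLIntegral_mono' measurableSet_Ioc fun τ hτ => ?_)
        (lintegral_mono_set (Set.Ioc_subset_Ioc_left ht.le))
      have h0 := ht.trans hτ.1
      rw [← ENNReal.ofReal_pow (mul_nonneg (by positivity) (hB0 τ)), mul_pow,
        ENNReal.ofReal_mul (by positivity), ← Real.rpow_natCast, ← Real.rpow_mul h0.le,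
        mul_left_comm]
      norm_num
      gcongr
      exact ofReal_sq_setIntegral_homothety_le hf hf0 x τ
    · refine Measurable.mul (by fun_prop) ?_
      refine Measurable.lintegral_prod_right' (f := fun p : ℝ × (Fin n → ℝ) =>
        ENNReal.ofReal (f (x + p.1 • (p.2 - x)) ^ 2)) ?_
      fun_prop

lemma add_smul_sub_mem_of_convex {E : Type*} [AddCommGroup E] [Module ℝ E] {Ω : Set E}
    (hΩ : Convex ℝ Ω) {x y : E} (hx : x ∈ Ω) (hy : y ∈ Ω) {τ : ℝ} (h0 : 0 ≤ τ) (h1 : τ ≤ 1) :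
    x + τ • (y - x) ∈ Ω := by
  have := hΩ hx hy (sub_nonneg.2 h1) h0 (by ring)
  convert this using 1
  rw [smul_sub, sub_smul, one_smul]
  abel

lemma setLIntegral_homothety_le {Ω K : Set (Fin n → ℝ)} (hΩ : Convex ℝ Ω)
    (ho : IsOpen Ω) (hK : IsCompact K) (hKΩ : K ⊆ Ω) {g : (Fin n → ℝ) → ENNReal}
    (hg : Measurable g) :
    ∫⁻ x in Ω, ∫⁻ y in K, g (x + (1 / 2 : ℝ) • (y - x)) ≤
      volume K * 2 ^ n * ∫⁻ z in Ω, g z := by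
  have hgm := hg.indicator ho.measurableSet
  calc _ ≤ ∫⁻ x in Ω, ∫⁻ y in K, Ω.indicator g (x + (1 / 2 : ℝ) • (y - x)) := by
        refine setLIntegral_mono' ho.measurableSet fun x hx =>
          setLIntegral_mono' hK.measurableSet fun y hy => ?_
        rw [Set.indicator_of_mem]
        exact add_smul_sub_mem_of_convex hΩ hx (hKΩ hy) (by norm_num) (by norm_num)
    _ ≤ ∫⁻ x, ∫⁻ y in K, Ω.indicator g (x + (1 / 2 : ℝ) • (y - x)) := setLIntegral_le_lintegral _ _
    _ = ∫⁻ y in K, ∫⁻ x, Ω.indicator g (x + (1 / 2 : ℝ) • (y - x)) := by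
        rw [lintegral_lintegral_swap]
        refine Measurable.aemeasurable ?_
        exact hgm.comp (show Measurable fun p : (Fin n → ℝ) × (Fin n → ℝ) =>
          p.1 + (1 / 2 : ℝ) • (p.2 - p.1) by fun_prop)
    _ ≤ ∫⁻ y in K, 2 ^ n * ∫⁻ z, Ω.indicator g z :=
        lintegral_mono fun y => lintegral_homothety_le y le_rfl
    _ = _ := by
        rw [setLIntegral_const, lintegral_indicator ho.measurableSet]
        ring

lemma exists_lintegral_sq_le {Ω K : Set (Fin n → ℝ)} (hΩ : Convex ℝ Ω) (ho : IsOpen Ω)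
    (hne : Ωᶜ.Nonempty) (hK : IsCompact K) (hKΩ : K ⊆ Ω) {c : ℝ} (hc : 0 < c)
    (hKc : ∀ y ∈ K, c ≤ Metric.infDist y Ωᶜ) {κ : ℝ} (hκ : 0 < κ) :
    ∃ C : ENNReal, C ≠ ⊤ ∧ ∀ f g : (Fin n → ℝ) → ℝ, Continuous f → (∀ x, 0 ≤ f x) →
      Continuous g → (∀ x, 0 ≤ g x) → ∀ (t : (Fin n → ℝ) → ℝ) (S : Set (Fin n → ℝ)),
      MeasurableSet S → S ⊆ Ω →
      (∀ x ∈ S, t x ≤ 1 / 2 ∧ κ * Metric.infDist x Ωᶜ ≤ t x) →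
      ∫⁻ x in S, ENNReal.ofReal (((∫ y in K, f (x + (1 / 2 : ℝ) • (y - x))) +
        ∫ τ in (t x)..(1 / 2), τ⁻¹ * ∫ y in K, g (x + τ • (y - x))) ^ 2) ≤
      C * ((∫⁻ x in Ω, ENNReal.ofReal (f x ^ 2)) + ∫⁻ x in Ω, ENNReal.ofReal (g x ^ 2)) := by
  have hKtop : volume K ≠ ⊤ := hK.measure_lt_top.ne
  set C1 : ENNReal := 2 * (volume K * (volume K * 2 ^ n)) with hC1
  set C2 : ENNReal := 2 * (ENNReal.ofReal (2 * κ ^ (-(1 / 2) : ℝ)) * (volume K *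
    (volume K * (2 ^ n * (8 * ENNReal.ofReal (c ^ (-(1 / 2) : ℝ))))))) with hC2
  refine ⟨C1 + C2, ?_, fun f g hf hf0 hg hg0 t S hS hSΩ hSt => ?_⟩
  · finiteness
  set F : (Fin n → ℝ) → ENNReal := fun x => ∫⁻ y in K,
    ENNReal.ofReal (f (x + (1 / 2 : ℝ) • (y - x)) ^ 2) with hF
  set γ : (Fin n → ℝ) → ENNReal := Ω.indicator fun x => ENNReal.ofReal (g x ^ 2) with hγ
  have hγm : Measurable γ := Measurable.indicator (by fun_prop) ho.measurableSet
  set H : (Fin n → ℝ) → ENNReal := fun x =>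
    ENNReal.ofReal (Metric.infDist x Ωᶜ ^ (-(1 / 2) : ℝ)) *
        ∫⁻ τ in Set.Ioc 0 (1 / 2 : ℝ), ENNReal.ofReal (τ ^ (-(1 / 2) : ℝ)) *
          ∫⁻ y in K, γ (x + τ • (y - x)) with hH
  have hFm : Measurable F := by
    refine Measurable.lintegral_prod_right' (f := fun p : (Fin n → ℝ) × (Fin n → ℝ) =>
        ENNReal.ofReal (f (p.1 + (1 / 2 : ℝ) • (p.2 - p.1)) ^ 2)) ?_
    fun_prop
  have hpt : ∀ x ∈ S, ENNReal.ofReal (((∫ y in K, f (x + (1 / 2 : ℝ) • (y - x))) +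
        ∫ τ in (t x)..(1 / 2), τ⁻¹ * ∫ y in K, g (x + τ • (y - x))) ^ 2) ≤
      2 * (volume K * F x) +
        2 * (ENNReal.ofReal (2 * κ ^ (-(1 / 2) : ℝ)) * (volume K * H x)) := by
    intro x hx
    obtain ⟨h1, h2⟩ := hSt x hx
    have hd : 0 < Metric.infDist x Ωᶜ :=
      (ho.isClosed_compl.notMem_iff_infDist_pos hne).1 (fun h => h (hSΩ hx))
    have ht : 0 < t x := lt_of_lt_of_le (by positivity) h2
    refine (ENNReal.ofReal_le_ofReal (add_sq_le (a := ∫ y in K, f (x + (1 / 2 : ℝ) • (y - x)))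
      (b := ∫ τ in (t x)..(1 / 2), τ⁻¹ * ∫ y in K, g (x + τ • (y - x))))).trans ?_
    rw [mul_add, ENNReal.ofReal_add (by positivity) (by positivity),
      ENNReal.ofReal_mul (by norm_num), ENNReal.ofReal_mul (by norm_num), ENNReal.ofReal_ofNat]
    gcongr
    · exact ofReal_sq_setIntegral_homothety_le hf hf0 x _
    refine (ofReal_sq_integral_inv_mul_le hK hg hg0 x ht h1).trans ?_
    have e1 : ENNReal.ofReal (2 * t x ^ (-(1 / 2) : ℝ)) ≤
        ENNReal.ofReal (2 * κ ^ (-(1 / 2) : ℝ)) *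
          ENNReal.ofReal (Metric.infDist x Ωᶜ ^ (-(1 / 2) : ℝ)) := by
      rw [← ENNReal.ofReal_mul (by positivity), mul_assoc, ← Real.mul_rpow hκ.le hd.le]
      refine ENNReal.ofReal_le_ofReal (mul_le_mul_of_nonneg_left ?_ (by norm_num))
      exact Real.rpow_le_rpow_of_nonpos (by positivity) h2 (by norm_num)
    refine (mul_le_mul' e1 le_rfl).trans ?_
    rw [mul_assoc, hH]
    refine mul_le_mul' le_rfl ?_
    rw [mul_left_comm]
    refine mul_le_mul' le_rfl (mul_le_mul' le_rfl ?_)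
    refine setLIntegral_mono' measurableSet_Ioc fun τ hτ => mul_le_mul' le_rfl ?_
    refine setLIntegral_mono' hK.measurableSet fun y hy => ?_
    rw [hγ, Set.indicator_of_mem]
    exact add_smul_sub_mem_of_convex hΩ (hSΩ hx) (hKΩ hy) hτ.1.le (hτ.2.trans (by norm_num))
  calc _ ≤ ∫⁻ x in S, (2 * (volume K * F x) +
        2 * (ENNReal.ofReal (2 * κ ^ (-(1 / 2) : ℝ)) * (volume K * H x))) :=
      setLIntegral_mono' hS hpt
    _ ≤ ∫⁻ x in Ω, (2 * (volume K * F x) +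
        2 * (ENNReal.ofReal (2 * κ ^ (-(1 / 2) : ℝ)) * (volume K * H x))) :=
      lintegral_mono_set hSΩ
    _ = 2 * (volume K * ∫⁻ x in Ω, F x) +
        2 * (ENNReal.ofReal (2 * κ ^ (-(1 / 2) : ℝ)) * (volume K * ∫⁻ x in Ω, H x)) := by
      rw [lintegral_add_left (by fun_prop), lintegral_const_mul' _ _ (by finiteness),
        lintegral_const_mul' _ _ hKtop, lintegral_const_mul' _ _ (by finiteness),
        lintegral_const_mul' _ _ (by finiteness), lintegral_const_mul' _ _ hKtop]
    _ ≤ C1 * (∫⁻ x in Ω, ENNReal.ofReal (f x ^ 2)) +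
        C2 * ∫⁻ x in Ω, ENNReal.ofReal (g x ^ 2) := by
      have hA := setLIntegral_homothety_le hΩ ho hK hKΩ
        (g := fun x => ENNReal.ofReal (f x ^ 2)) (by fun_prop)
      have hB := lintegral_weighted_hardy hΩ ho hne hc hK.measurableSet hKc hγm
      rw [hγ, lintegral_indicator ho.measurableSet] at hB
      rw [hC1, hC2]
      simp only [mul_assoc] at hA hB ⊢
      gcongr
    _ ≤ _ := by
      rw [mul_add]
      gcongr
      · exact le_self_add
      · exact le_add_self

end WeightedHardyReal

section Cutoff

open scoped Convolution

variable {n : ℕ}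

lemma exists_smooth_approx_of_lipschitz {f : (Fin n → ℝ) → ℝ} (hf : LipschitzWith 1 f)
    {M : ℝ} (hf0 : ∀ x, 0 ≤ f x) (hfM : ∀ x, f x ≤ M) {δ : ℝ} (hδ : 0 < δ) :
    ∃ g : (Fin n → ℝ) → ℝ, ContDiff ℝ (⊤ : ℕ∞) g ∧ LipschitzWith 1 g ∧ (∀ x, 0 ≤ g x) ∧
      (∀ x, g x ≤ M) ∧ (∀ x, |g x - f x| ≤ δ) ∧
      ∀ x, (∀ y, dist y x < δ → f y = 0) → g x = 0 := by
  let φ : ContDiffBump (0 : Fin n → ℝ) := ⟨δ / 2, δ, by positivity, by linarith⟩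
  set ψ := φ.normed volume with hψ
  have hψc : HasCompactSupport ψ := φ.hasCompactSupport_normed
  have hψs : ContDiff ℝ (⊤ : ℕ∞) ψ := φ.contDiff_normed
  have hψ0 : ∀ x, 0 ≤ ψ x := φ.nonneg_normed
  have hψi : ∫ x, ψ x = 1 := φ.integral_normed
  have hψint : Integrable ψ := hψs.continuous.integrable_of_hasCompactSupport hψc
  have hfc := hf.continuous
  have hint : ∀ x, Integrable fun s => ψ s * f (x - s) := fun x => by
    refine Continuous.integrable_of_hasCompactSupport ?_ hψc.mul_right
    have := hψs.continuous
    fun_prop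
  set g : (Fin n → ℝ) → ℝ := fun x => ∫ s, ψ s * f (x - s) with hg
  have hgc : g = (ψ ⋆[ContinuousLinearMap.lsmul ℝ ℝ, volume] f) := by
    ext x
    simp [hg, convolution_def]
  refine ⟨g, ?_, ?_, ?_, ?_, ?_, ?_⟩
  · rw [hgc]
    exact hψc.contDiff_convolution_left _ hψs hfc.locallyIntegrable
  · refine LipschitzWith.of_dist_le_mul fun x y => ?_
    rw [dist_eq_norm, hg]
    simp only
    rw [← integral_sub (hint x) (hint y)]
    calc _ ≤ ∫ s, ψ s * dist x y := by
          refine norm_integral_le_of_norm_le (hψint.mul_const _)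
            (Filter.Eventually.of_forall fun s => ?_)
          rw [← mul_sub, norm_mul, Real.norm_of_nonneg (hψ0 s), ← dist_eq_norm]
          gcongr
          · exact hψ0 s
          · simpa using hf.dist_le_mul (x - s) (y - s)
      _ = _ := by rw [integral_mul_const, hψi]; simp
  · exact fun x => integral_nonneg fun s => mul_nonneg (hψ0 s) (hf0 _)
  · intro x
    calc g x ≤ ∫ s, ψ s * M := integral_mono (hint x) (hψint.mul_const _) fun s =>
          mul_le_mul_of_nonneg_left (hfM _) (hψ0 s)
      _ = M := by rw [integral_mul_const, hψi, one_mul]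
  · intro x
    have := φ.dist_normed_convolution_le (μ := volume) (x₀ := x) (ε := δ)
      hfc.aestronglyMeasurable fun y hy => by
        have := hf.dist_le_mul y x
        simp only [NNReal.coe_one, one_mul] at this
        exact this.trans (le_of_lt hy)
    rwa [← hψ, ← hgc, Real.dist_eq] at this
  · intro x hx
    have := φ.dist_normed_convolution_le (μ := volume) (x₀ := x) (ε := 0)
      hfc.aestronglyMeasurable fun y hy => by
        rw [hx y hy, hx x (by simpa using hδ), dist_self]
    rw [← hψ, ← hgc, hx x (by simpa using hδ)] at this
    simpa using this

lemma exists_cutoff {Ω : Set (Fin n → ℝ)} (ho : IsOpen Ω) (hb : Bornology.IsBounded Ω)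
    (hne : Ωᶜ.Nonempty) :
    ∃ κ : ℝ, 0 < κ ∧ ∀ ε : ENNReal, 0 < ε → ∃ t : (Fin n → ℝ) → ℝ, ContDiff ℝ (⊤ : ℕ∞) t ∧
      (∃ K, IsCompact K ∧ K ⊆ Ω ∧ ∀ x, x ∉ K → t x = 0) ∧ (∀ x, 0 ≤ t x) ∧
      (∀ x, t x ≤ 1 / 2) ∧ (∀ i x, |pd t i x| ≤ 1) ∧
      volume {x | x ∈ Ω ∧ t x < κ * Metric.infDist x Ωᶜ} < ε := by
  set d : (Fin n → ℝ) → ℝ := fun x => Metric.infDist x Ωᶜ with hd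
  have hdc : Continuous d := Metric.continuous_infDist_pt _
  obtain ⟨q, hq⟩ := hne
  obtain ⟨M, hM0, hM⟩ : ∃ M, 0 < M ∧ ∀ x, d x ≤ M := by
    obtain ⟨r, hr⟩ := hb.subset_closedBall q
    refine ⟨max r 1, by positivity, fun x => ?_⟩
    by_cases hx : x ∈ Ω
    · exact (Metric.infDist_le_dist_of_mem hq).trans ((hr hx).trans (le_max_left _ _))
    · rw [hd]
      simp only
      rw [Metric.infDist_zero_of_mem hx]
      positivity
  set κ := min 1 (1 / (2 * M)) with hκ
  have hκ0 : 0 < κ := by positivity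
  have hκ1 : κ ≤ 1 := min_le_left _ _
  have hκM : κ * M ≤ 1 / 2 := by
    calc κ * M ≤ 1 / (2 * M) * M := by gcongr; exact min_le_right _ _
      _ = 1 / 2 := by field_simp
  refine ⟨κ / 2, by positivity, fun ε hε => ?_⟩
  obtain ⟨δ, hδ, hvol⟩ : ∃ δ : ℝ, 0 < δ ∧ volume {x | x ∈ Ω ∧ d x < 6 * δ} < ε := by
    have hT := tendsto_measure_iInter_atTop (μ := (volume : Measure (Fin n → ℝ)))
      (s := fun k : ℕ => {x | x ∈ Ω ∧ d x < 6 * (1 / ((k : ℝ) + 1))})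
      (fun k => (ho.inter (isOpen_lt hdc continuous_const)).measurableSet.nullMeasurableSet)
      (fun k l hkl x hx => ⟨hx.1, hx.2.trans_le (by gcongr)⟩)
      ⟨0, ((measure_mono fun x hx => hx.1).trans_lt hb.measure_lt_top).ne⟩
    have hemp : ⋂ k : ℕ, {x | x ∈ Ω ∧ d x < 6 * (1 / ((k : ℝ) + 1))} = ∅ := by
      refine Set.eq_empty_of_forall_notMem fun x hx => ?_
      rw [Set.mem_iInter] at hx
      have hpos : 0 < d x := (ho.isClosed_compl.notMem_iff_infDist_pos ⟨q, hq⟩).1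
        (fun h => h (hx 0).1)
      obtain ⟨k, hk⟩ := exists_nat_one_div_lt (show 0 < d x / 6 by positivity)
      have := (hx k).2
      linarith
    rw [hemp, measure_empty] at hT
    obtain ⟨k, hk⟩ := (hT.eventually (gt_mem_nhds hε)).exists
    exact ⟨1 / ((k : ℝ) + 1), by positivity, hk⟩
  set f : (Fin n → ℝ) → ℝ := fun x => max (d x - 2 * δ) 0 with hf
  have hfL : LipschitzWith 1 f := by
    have h1 : LipschitzWith 1 fun x => d x - 2 * δ := by
      refine LipschitzWith.of_dist_le_mul fun x y => ?_
      have := (Metric.lipschitz_infDist_pt Ωᶜ).dist_le_mul x y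
      simpa [Real.dist_eq] using this
    exact h1.max_const 0
  obtain ⟨g, hgs, hgL, hg0, hgM, hgf, hgz⟩ := exists_smooth_approx_of_lipschitz hfL (M := M)
    (fun x => le_max_right _ _) (fun x => max_le (by linarith [hM x]) hM0.le) hδ
  refine ⟨fun x => κ * g x, contDiff_const.mul hgs, ⟨{x | δ ≤ d x}, ?_, ?_, ?_⟩, ?_, ?_, ?_, ?_⟩
  · refine Metric.isCompact_of_isClosed_isBounded (isClosed_le continuous_const hdc)
      (hb.subset fun x hx => ?_)
    by_contra h
    have : d x = 0 := Metric.infDist_zero_of_mem h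
    have hx' : δ ≤ d x := hx
    linarith
  · intro x hx
    by_contra h
    have : d x = 0 := Metric.infDist_zero_of_mem h
    have hx' : δ ≤ d x := hx
    linarith
  · intro x hx
    have hx' : d x < δ := not_le.1 hx
    suffices g x = 0 by simp [this]
    refine hgz x fun y hy => ?_
    have : d y ≤ d x + dist y x := Metric.infDist_le_infDist_add_dist
    exact max_eq_right (by linarith)
  · exact fun x => mul_nonneg hκ0.le (hg0 x)
  · exact fun x => (mul_le_mul_of_nonneg_left (hgM x) hκ0.le).trans hκM
  · intro i x
    rw [pd_const_mul hgs, abs_mul, abs_of_pos hκ0]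
    have h1 : |pd g i x| ≤ 1 := by
      refine ((fderiv ℝ g x).le_opNorm _).trans ?_
      have := norm_fderiv_le_of_lipschitz ℝ hgL (x₀ := x)
      rw [Pi.norm_single]
      simpa using this
    nlinarith [abs_nonneg (pd g i x)]
  · refine (measure_mono fun x hx => ?_).trans_lt hvol
    refine ⟨hx.1, ?_⟩
    by_contra! h
    have h1 := hx.2
    have h2 := (abs_le.1 (hgf x)).1
    have h3 : d x - 2 * δ ≤ f x := le_max_left _ _
    have h4 : κ * (d x / 2) ≤ κ * g x := by
      gcongr
      linarith
    simp only at h1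
    linarith

end Cutoff

section VariableAverage

variable {n : ℕ}

lemma contDiff_integral_of_compact {F : (Fin n → ℝ) → (Fin n → ℝ) → ℝ}
    (hF : ContDiff ℝ (⊤ : ℕ∞) (fun p : (Fin n → ℝ) × (Fin n → ℝ) => F p.1 p.2))
    {K : Set (Fin n → ℝ)} (hK : IsCompact K) (hFK : ∀ x y, y ∉ K → F x y = 0) :
    ContDiff ℝ (⊤ : ℕ∞) fun x => ∫ y, F x y := by
  have h := contDiffOn_convolution_right_with_param_comp (𝕜 := ℝ) (n := (⊤ : ℕ∞))
    (μ := (volume : Measure (Fin n → ℝ))) (ContinuousLinearMap.lsmul ℝ ℝ : ℝ →L[ℝ] ℝ →L[ℝ] ℝ)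
    (s := Set.univ) (v := fun _ : Fin n → ℝ => (0 : Fin n → ℝ)) contDiffOn_const
    (f := fun _ => (1 : ℝ)) (g := fun x z => F x (-z)) (k := -K) isOpen_univ hK.neg
    (fun x z _ hz => hFK x (-z) (by simpa using hz)) (locallyIntegrable_const 1)
    (by
      refine ContDiff.contDiffOn ?_
      exact hF.comp (g := fun p : (Fin n → ℝ) × (Fin n → ℝ) => F p.1 p.2)
        (f := fun p : (Fin n → ℝ) × (Fin n → ℝ) => (p.1, -p.2)) (by fun_prop))
  rw [contDiffOn_univ] at h
  simpa [MeasureTheory.convolution_def] using h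

variable {φ f t : (Fin n → ℝ) → ℝ} {K : Set (Fin n → ℝ)}

lemma contDiff_homAvg_comp (hφ : ContDiff ℝ (⊤ : ℕ∞) φ) (hf : ContDiff ℝ (⊤ : ℕ∞) f)
    (ht : ContDiff ℝ (⊤ : ℕ∞) t) (hK : IsCompact K) (hφK : ∀ y, y ∉ K → φ y = 0) :
    ContDiff ℝ (⊤ : ℕ∞) fun x => homAvg φ f x (t x) := by
  refine contDiff_integral_of_compact (F := fun x y => φ y * f (x + t x • (y - x))) ?_ hK
    (fun x y hy => by simp [hφK y hy])
  exact (hφ.comp contDiff_snd).mul (hf.comp (contDiff_fst.add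
    ((ht.comp contDiff_fst).smul (contDiff_snd.sub contDiff_fst))))

lemma pd_homAvg_comp (hφ : ContDiff ℝ (⊤ : ℕ∞) φ) (hf : ContDiff ℝ (⊤ : ℕ∞) f)
    (ht : ContDiff ℝ (⊤ : ℕ∞) t) (hK : IsCompact K) (hφK : ∀ y, y ∉ K → φ y = 0)
    (i : Fin n) (x : Fin n → ℝ) :
    pd (fun x => homAvg φ f x (t x)) i x = (1 - t x) * homAvg φ (pd f i) x (t x) +
      pd t i x * ∑ k, homAvg (fun y => φ y * (y k - x k)) (pd f k) x (t x) := by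
  set e : Fin n → ℝ := Pi.single i 1 with he
  have hline : ∀ s : ℝ, HasDerivAt (fun s : ℝ => x + s • e) e s := fun s => by
    simpa using ((hasDerivAt_id s).smul_const e).const_add x
  have htc := ht.continuous
  have hfd : Continuous (fderiv ℝ f) := hf.continuous_fderiv (by simp)
  have htd : Continuous (fderiv ℝ t) := ht.continuous_fderiv (by simp)
  have hfc := hf.continuous
  have hφc := hφ.continuous
  have hz : ∀ (s : ℝ) (y : Fin n → ℝ), HasDerivAt
      (fun s : ℝ => (x + s • e) + t (x + s • e) • (y - (x + s • e)))
      (e + (t (x + s • e) • (-e) + fderiv ℝ t (x + s • e) e • (y - (x + s • e)))) s :=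
    fun s y => (hline s).add ((((ht.differentiable (by simp) _).hasFDerivAt.comp_hasDerivAt s
      (hline s))).smul ((hline s).const_sub y))
  have h := hasDerivAt_integral_of_compact
    (F := fun s y => φ y * f ((x + s • e) + t (x + s • e) • (y - (x + s • e))))
    (F' := fun s y => φ y * fderiv ℝ f ((x + s • e) + t (x + s • e) • (y - (x + s • e)))
      (e + (t (x + s • e) • (-e) + fderiv ℝ t (x + s • e) e • (y - (x + s • e))))) hK
    (fun s => by fun_prop) (by fun_prop) (fun s y hy => by simp [hφK y hy])
    (fun s y hy => by simp [hφK y hy])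
    (fun s y => (((hf.differentiable (by simp) _).hasFDerivAt.comp_hasDerivAt s
      (hz s y))).const_mul (φ y)) 0
  have h' : HasDerivAt (fun s : ℝ => homAvg φ f (x + s • e) (t (x + s • e)))
      (pd (fun x => homAvg φ f x (t x)) i x) 0 := by
    have hd := (contDiff_homAvg_comp hφ hf ht hK hφK).differentiable (by simp)
    have := (hd (x + (0 : ℝ) • e)).hasFDerivAt.comp_hasDerivAt (0 : ℝ) (hline 0)
    simpa [pd, Function.comp_def] using this
  rw [h'.unique h]
  simp only [zero_smul, add_zero]
  simp only [homAvg]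
  rw [← integral_finsetSum _ fun k _ => integrable_homAvg_integrand
    (f := fun y => φ y * (y k - x k)) (hφc.mul ((continuous_apply k).sub continuous_const))
    (contDiff_pd hf k).continuous hK (fun y hy => by simp [hφK y hy]) x (t x),
    ← integral_const_mul, ← integral_const_mul, ← integral_add]
  · refine integral_congr_ae (Filter.Eventually.of_forall fun y => ?_)
    simp only
    rw [map_add, map_add, map_smul, map_smul, map_neg, fderiv_apply_eq_sum_pd f _ (y - x)]
    simp only [smul_eq_mul, Finset.mul_sum, mul_add, Pi.sub_apply]
    rw [show fderiv ℝ f (x + t x • (y - x)) e = pd f i (x + t x • (y - x)) from rfl,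
      show fderiv ℝ t x e = pd t i x from rfl, ← add_assoc]
    congr 1
    · ring
    · exact Finset.sum_congr rfl fun k _ => by ring
  · exact (integrable_homAvg_integrand hφc (contDiff_pd hf i).continuous hK hφK x _).const_mul _
  · exact (integrable_finsetSum _ fun k _ => integrable_homAvg_integrand
      (f := fun y => φ y * (y k - x k)) (hφc.mul ((continuous_apply k).sub continuous_const))
      (contDiff_pd hf k).continuous hK (fun y hy => by simp [hφK y hy]) x (t x)).const_mul _

end VariableAverage

section Assembly

variable {n : ℕ} {Ω K : Set (Fin n → ℝ)} {φ : (Fin n → ℝ) → ℝ}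

lemma integrableOn_of_continuous_of_isBounded {f : (Fin n → ℝ) → ℝ} (hf : Continuous f)
    (hb : Bornology.IsBounded Ω) : IntegrableOn f Ω :=
  (hf.continuousOn.integrableOn_compact hb.isCompact_closure).mono_set subset_closure

lemma isKernel_const (hφ : ContDiff ℝ (⊤ : ℕ∞) φ) (hφK : ∀ y, y ∉ K → φ y = 0) :
    IsKernel K fun _ y => φ y :=
  ⟨hφ.comp contDiff_snd, fun _ y hy => hφK y hy⟩

lemma abs_pd_homAvg_comp_le (hφ : ContDiff ℝ (⊤ : ℕ∞) φ) (hK : IsCompact K)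
    (hφK : ∀ y, y ∉ K → φ y = 0) {f t : (Fin n → ℝ) → ℝ} (hf : ContDiff ℝ (⊤ : ℕ∞) f)
    (ht : ContDiff ℝ (⊤ : ℕ∞) t) (ht0 : ∀ x, 0 ≤ t x) (ht2 : ∀ x, t x ≤ 1 / 2)
    (htd : ∀ i x, |pd t i x| ≤ 1) (i : Fin n) (x : Fin n → ℝ) :
    |pd (fun x => homAvg φ f x (t x)) i x| ≤ |homAvg φ (pd f i) x (t x)| +
      ∑ k, |homAvg (fun y => φ y * (y k - x k)) (pd f k) x (t x)| := by
  rw [pd_homAvg_comp hφ hf ht hK hφK]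
  refine (abs_add_le _ _).trans ?_
  rw [abs_mul, abs_mul]
  gcongr
  · refine mul_le_of_le_one_left (abs_nonneg _) ?_
    rw [abs_of_nonneg (by linarith [ht2 x])]
    linarith [ht0 x]
  · exact (mul_le_of_le_one_left (abs_nonneg _) (htd i x)).trans (Finset.abs_sum_le_sum_abs _ _)

lemma exists_abs_pd_homAvg_comp_le (hn : 3 ≤ n) (hφ : ContDiff ℝ (⊤ : ℕ∞) φ) (hK : IsCompact K)
    (hφK : ∀ y, y ∉ K → φ y = 0) (hΩ : Bornology.IsBounded Ω) :
    ∃ C, 0 < C ∧ ∀ u : (Fin n → ℝ) → Fin n → ℝ,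
      (∀ j, ContDiff ℝ (⊤ : ℕ∞) (fun x => u x j)) → ∀ t : (Fin n → ℝ) → ℝ,
      ContDiff ℝ (⊤ : ℕ∞) t → (∀ x, 0 ≤ t x) → (∀ x, t x ≤ 1 / 2) → (∀ i x, |pd t i x| ≤ 1) →
      ∀ x ∈ Ω, 0 < t x → ∀ i j, |pd (fun x => homAvg φ (fun y => u y j) x (t x)) i x| ≤
        C * ((∫ y in K, fieldNorm u (x + (1 / 2 : ℝ) • (y - x))) +
          ∫ τ in (t x)..(1 / 2), τ⁻¹ * ∫ y in K, ltfNorm u (x + τ • (y - x))) := by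
  have hker := isKernel_const hφ hφK
  obtain ⟨C0, hC00, hC0⟩ := exists_abs_homAvg_pd_le hn hker hK hΩ
  choose C1 hC10 hC1 using fun k => exists_abs_homAvg_pd_le hn (hker.mul_sub k) hK hΩ
  refine ⟨C0 + ∑ k, C1 k, add_pos_of_pos_of_nonneg hC00 (Finset.sum_nonneg fun k _ => (hC10 k).le),
    fun u hu t ht ht0 ht2 htd x hx htx i j => ?_⟩
  refine (abs_pd_homAvg_comp_le hφ hK hφK (hu j) ht ht0 ht2 htd i x).trans ?_
  rw [add_mul, Finset.sum_mul]
  exact add_le_add (hC0 u hu x hx (t x) htx (ht2 x) i j)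
    (Finset.sum_le_sum fun k _ => hC1 k u hu x hx (t x) htx (ht2 x) k j)

lemma exists_bound_pd_homAvg_comp (hφ : ContDiff ℝ (⊤ : ℕ∞) φ) (hK : IsCompact K)
    (hφK : ∀ y, y ∉ K → φ y = 0) (hΩ : Bornology.IsBounded Ω) (hc : Convex ℝ Ω) (hKΩ : K ⊆ Ω)
    {u : (Fin n → ℝ) → Fin n → ℝ} (hu : ∀ j, ContDiff ℝ (⊤ : ℕ∞) (fun x => u x j)) :
    ∃ C, ∀ t : (Fin n → ℝ) → ℝ,
      ContDiff ℝ (⊤ : ℕ∞) t → (∀ x, 0 ≤ t x) → (∀ x, t x ≤ 1 / 2) → (∀ i x, |pd t i x| ≤ 1) →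
      ∀ x ∈ Ω, ∑ i, ∑ j, pd (fun x => homAvg φ (fun y => u y j) x (t x)) i x ^ 2 ≤ C := by
  have hker := isKernel_const hφ hφK
  obtain ⟨C, hC0, hC⟩ := exists_forall_abs_homAvg_le (ι := Option (Fin n))
    (G := fun a x y => a.elim (φ y) fun k => φ y * (y k - x k))
    (fun a => by cases a with
      | none => exact hker
      | some k => exact hker.mul_sub k) hK hΩ
  have hb : ∀ i j, ∃ M, 0 ≤ M ∧ ∀ x ∈ Ω, |pd (fun y => u y j) i x| ≤ M := fun i j => by
    obtain ⟨M, hM⟩ := hΩ.isCompact_closure.exists_bound_of_continuousOn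
      (contDiff_pd (hu j) i).continuous.continuousOn
    exact ⟨max M 0, le_max_right _ _,
      fun x hx => (hM x (subset_closure hx)).trans (le_max_left _ _)⟩
  choose M hM0 hM using hb
  have hKfin : volume K ≠ ⊤ := hK.measure_lt_top.ne
  have hA : ∀ (a : Option (Fin n)) (x : Fin n → ℝ), x ∈ Ω → ∀ τ, 0 ≤ τ → τ ≤ 1 / 2 → ∀ i j,
      |homAvg (fun y => a.elim (φ y) fun k => φ y * (y k - x k)) (pd (fun y => u y j) i) x τ| ≤
        C * (volume.real K * M i j) := by
    intro a x hx τ h0 h1 i j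
    have hcont := (contDiff_pd (hu j) i).continuous
    refine (hC a x hx _ _ hcont hcont.abs (fun z => le_rfl) τ).trans ?_
    gcongr
    calc _ ≤ ∫ y in K, M i j := by
          refine setIntegral_mono_on (ContinuousOn.integrableOn_compact hK (by fun_prop))
            (integrableOn_const hKfin) hK.measurableSet fun y hy => ?_
          exact hM i j _ (add_smul_sub_mem_of_convex hc hx (hKΩ hy) h0 (by linarith))
      _ = _ := by simp
  refine ⟨∑ i, ∑ j, (C * (volume.real K * M i j) + ∑ k, C * (volume.real K * M k j)) ^ 2,
    fun t ht ht0 ht2 htd x hx => Finset.sum_le_sum fun i _ => Finset.sum_le_sum fun j _ => ?_⟩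
  refine sq_le_sq' ?_ ?_
  all_goals
    have h := (abs_pd_homAvg_comp_le hφ hK hφK (hu j) ht ht0 ht2 htd i x).trans
      (add_le_add (hA none x hx (t x) (ht0 x) (ht2 x) i j)
        (Finset.sum_le_sum fun k _ => hA (some k) x hx (t x) (ht0 x) (ht2 x) k j))
  · exact (abs_le.1 h).1
  · exact (abs_le.1 h).2

lemma sum_sq_ltf_le_sum_sq_pd (hn : n ≠ 0) (u : (Fin n → ℝ) → Fin n → ℝ) (x : Fin n → ℝ) :
    ∑ i, ∑ j, ltf u i j x ^ 2 ≤ ∑ i, ∑ j, pd (fun y => u y j) i x ^ 2 := by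
  have h := sum_sq_ltf hn u x
  have h1 : 0 ≤ 2 / (n : ℝ) * diver u x ^ 2 := by positivity
  have h2 : 2 * ∑ i, ∑ j, pd (fun y => u y j) i x * pd (fun y => u y i) j x ≤
      2 * ∑ i, ∑ j, pd (fun y => u y j) i x ^ 2 := by
    have e : ∑ i, ∑ j, pd (fun y => u y i) j x ^ 2 = ∑ i, ∑ j, pd (fun y => u y j) i x ^ 2 :=
      Finset.sum_comm
    calc _ ≤ ∑ i, ∑ j, (pd (fun y => u y j) i x ^ 2 + pd (fun y => u y i) j x ^ 2) := by
          simp only [Finset.mul_sum]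
          gcongr with i _ j _
          nlinarith [sq_nonneg (pd (fun y => u y j) i x - pd (fun y => u y i) j x)]
      _ = _ := by
          simp only [Finset.sum_add_distrib]
          rw [e, two_mul]
  linarith

lemma sum_sq_le_two_mul_add {f g h : Fin n → Fin n → ℝ} (hfg : ∀ i j, f i j = g i j + h i j) :
    ∑ i, ∑ j, f i j ^ 2 ≤ 2 * (∑ i, ∑ j, g i j ^ 2) + 2 * ∑ i, ∑ j, h i j ^ 2 := by
  simp only [Finset.mul_sum, ← Finset.sum_add_distrib]
  gcongr with i _ j _
  rw [hfg]
  nlinarith [sq_nonneg (g i j - h i j)]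

lemma ltf_sub {u w : (Fin n → ℝ) → Fin n → ℝ} (hu : ∀ j, ContDiff ℝ (⊤ : ℕ∞) (fun x => u x j))
    (hw : ∀ j, ContDiff ℝ (⊤ : ℕ∞) (fun x => w x j)) (i j : Fin n) (x : Fin n → ℝ) :
    ltf (fun y j => u y j - w y j) i j x = ltf u i j x - ltf w i j x := by
  simp only [ltf, strain, diver, pd_sub (hu _) (hw _), Finset.sum_sub_distrib]
  ring

lemma setIntegral_sum_sq_pd_le (hn : 2 ≤ n) (hb : Bornology.IsBounded Ω)
    {u w : (Fin n → ℝ) → Fin n → ℝ} (hu : ∀ j, ContDiff ℝ (⊤ : ℕ∞) (fun x => u x j))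
    (hw : ∀ j, ContDiff ℝ (⊤ : ℕ∞) (fun x => w x j)) (hK : IsCompact K) (hKΩ : K ⊆ Ω)
    (huw : ∀ x, x ∉ K → w x = u x) :
    ∫ x in Ω, ∑ i, ∑ j, pd (fun y => u y j) i x ^ 2 ≤
      8 * (∫ x in Ω, ∑ i, ∑ j, ltf u i j x ^ 2) +
        10 * ∫ x in Ω, ∑ i, ∑ j, pd (fun y => w y j) i x ^ 2 := by
  set v : (Fin n → ℝ) → Fin n → ℝ := fun y j => u y j - w y j with hv
  have hvs : ∀ j, ContDiff ℝ (⊤ : ℕ∞) (fun x => v x j) := fun j => (hu j).sub (hw j)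
  have hcp : ∀ {z : (Fin n → ℝ) → Fin n → ℝ}, (∀ j, ContDiff ℝ (⊤ : ℕ∞) (fun x => z x j)) →
      Continuous fun x => ∑ i, ∑ j, pd (fun y => z y j) i x ^ 2 := fun hz =>
    continuous_finsetSum _ fun i _ => continuous_finsetSum _ fun j _ =>
      (contDiff_pd (hz j) i).continuous.pow 2
  have hcl : ∀ {z : (Fin n → ℝ) → Fin n → ℝ}, (∀ j, ContDiff ℝ (⊤ : ℕ∞) (fun x => z x j)) →
      Continuous fun x => ∑ i, ∑ j, ltf z i j x ^ 2 := fun hz =>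
    continuous_finsetSum _ fun i _ => continuous_finsetSum _ fun j _ =>
      (contDiff_ltf hz i j).continuous.pow 2
  have hip := fun {z} hz => integrableOn_of_continuous_of_isBounded (hcp (z := z) hz) hb
  have hil := fun {z} hz => integrableOn_of_continuous_of_isBounded (hcl (z := z) hz) hb
  have hv0 : ∀ x, x ∉ K → v x = 0 := fun x hx => by
    ext j
    simp [hv, huw x hx]
  have hpv0 : ∀ i j x, x ∉ K → pd (fun y => v y j) i x = 0 := fun i j =>
    pd_eq_zero_of_notMem hK.isClosed (fun x hx => by rw [hv0 x hx]; rfl) i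
  have hkorn := integral_sq_pd_le_of_compact hn hvs hK hv0
  rw [← setIntegral_eq_integral_of_forall_compl_eq_zero (s := Ω)
      (f := fun x => ∑ i, ∑ j, pd (fun y => v y j) i x ^ 2)
      (fun x hx => by simp [hpv0 _ _ x fun h => hx (hKΩ h)]),
    ← setIntegral_eq_integral_of_forall_compl_eq_zero (s := Ω)
      (f := fun x => ∑ i, ∑ j, ltf v i j x ^ 2)
      (fun x hx => by simp [ltf, strain, diver, hpv0 _ _ x fun h => hx (hKΩ h)])] at hkorn
  have h1 : ∫ x in Ω, ∑ i, ∑ j, pd (fun y => u y j) i x ^ 2 ≤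
      2 * (∫ x in Ω, ∑ i, ∑ j, pd (fun y => v y j) i x ^ 2) +
        2 * ∫ x in Ω, ∑ i, ∑ j, pd (fun y => w y j) i x ^ 2 := by
    rw [← integral_const_mul, ← integral_const_mul,
      ← integral_add ((hip hvs).const_mul _) ((hip hw).const_mul _)]
    refine integral_mono (hip hu) (((hip hvs).const_mul _).add ((hip hw).const_mul _)) fun x => ?_
    refine sum_sq_le_two_mul_add fun i j => ?_
    rw [hv, pd_sub (hu j) (hw j)]
    ring
  have h2 : ∫ x in Ω, ∑ i, ∑ j, ltf v i j x ^ 2 ≤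
      2 * (∫ x in Ω, ∑ i, ∑ j, ltf u i j x ^ 2) +
        2 * ∫ x in Ω, ∑ i, ∑ j, pd (fun y => w y j) i x ^ 2 := by
    rw [← integral_const_mul, ← integral_const_mul,
      ← integral_add ((hil hu).const_mul _) ((hip hw).const_mul _)]
    refine integral_mono (hil hvs) (((hil hu).const_mul _).add ((hip hw).const_mul _)) fun x => ?_
    refine (sum_sq_le_two_mul_add (g := fun i j => ltf u i j x) (h := fun i j => -ltf w i j x)
      fun i j => ?_).trans ?_
    · rw [hv, ltf_sub hu hw]
      ring
    · have := sum_sq_ltf_le_sum_sq_pd (by omega : n ≠ 0) w x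
      simp only [neg_sq]
      gcongr
  linarith

lemma exists_setIntegral_sum_sq_pd_homAvg_le (hn : 3 ≤ n) (hφ : ContDiff ℝ (⊤ : ℕ∞) φ)
    (hK : IsCompact K) (hφK : ∀ y, y ∉ K → φ y = 0) (hb : Bornology.IsBounded Ω)
    (hc : Convex ℝ Ω) (ho : IsOpen Ω) (hne : Ωᶜ.Nonempty) (hKΩ : K ⊆ Ω) {c κ : ℝ} (hc0 : 0 < c)
    (hKc : ∀ y ∈ K, c ≤ Metric.infDist y Ωᶜ) (hκ : 0 < κ) :
    ∃ C, 0 < C ∧ ∀ u : (Fin n → ℝ) → Fin n → ℝ,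
      (∀ j, ContDiff ℝ (⊤ : ℕ∞) (fun x => u x j)) → ∀ t : (Fin n → ℝ) → ℝ,
      ContDiff ℝ (⊤ : ℕ∞) t → (∀ x, 0 ≤ t x) → (∀ x, t x ≤ 1 / 2) → (∀ i x, |pd t i x| ≤ 1) →
      ∫ x in {x | x ∈ Ω ∧ κ * Metric.infDist x Ωᶜ ≤ t x},
          ∑ i, ∑ j, pd (fun x => homAvg φ (fun y => u y j) x (t x)) i x ^ 2 ≤
        C * ∫ x in Ω, ((∑ i, u x i ^ 2) + ∑ i, ∑ j, ltf u i j x ^ 2) := by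
  obtain ⟨C1, hC10, hC1⟩ := exists_abs_pd_homAvg_comp_le hn hφ hK hφK hb
  obtain ⟨C2, hC2top, hC2⟩ := exists_lintegral_sq_le hc ho hne hK hKΩ hc0 hKc hκ
  refine ⟨n * n * C1 ^ 2 * (C2.toReal + 1), by positivity, fun u hu t ht ht0 ht2 htd => ?_⟩
  set S := {x | x ∈ Ω ∧ κ * Metric.infDist x Ωᶜ ≤ t x} with hS
  have hSm : MeasurableSet S := ho.measurableSet.inter
    (isClosed_le (continuous_const.mul (Metric.continuous_infDist_pt _))
      ht.continuous).measurableSet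
  have hSΩ : S ⊆ Ω := fun x hx => hx.1
  set D : (Fin n → ℝ) → ℝ := fun x =>
    ∑ i, ∑ j, pd (fun x => homAvg φ (fun y => u y j) x (t x)) i x ^ 2 with hD
  have hDc : Continuous D := continuous_finsetSum _ fun i _ => continuous_finsetSum _ fun j _ =>
    (contDiff_pd (contDiff_homAvg_comp hφ (hu j) ht hK hφK) i).continuous.pow 2
  have hD0 : ∀ x, 0 ≤ D x := fun x => by positivity
  set A : (Fin n → ℝ) → ℝ := fun x => (∫ y in K, fieldNorm u (x + (1 / 2 : ℝ) • (y - x))) +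
    ∫ τ in (t x)..(1 / 2), τ⁻¹ * ∫ y in K, ltfNorm u (x + τ • (y - x)) with hA
  have hDA : ∀ x ∈ S, D x ≤ n * n * C1 ^ 2 * A x ^ 2 := by
    intro x hx
    have hd : 0 < Metric.infDist x Ωᶜ :=
      (ho.isClosed_compl.notMem_iff_infDist_pos hne).1 (fun h => h hx.1)
    have htx : 0 < t x := lt_of_lt_of_le (by positivity) hx.2
    calc D x ≤ ∑ _i : Fin n, ∑ _j : Fin n, (C1 * A x) ^ 2 := by
          refine Finset.sum_le_sum fun i _ => Finset.sum_le_sum fun j _ => ?_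
          have h := hC1 u hu t ht ht0 ht2 htd x hx.1 htx i j
          exact sq_le_sq' (abs_le.1 h).1 (abs_le.1 h).2
      _ = _ := by
          simp
          ring
  set R : (Fin n → ℝ) → ℝ := fun x => (∑ i, u x i ^ 2) + ∑ i, ∑ j, ltf u i j x ^ 2 with hR
  have hU2 : ∀ x, fieldNorm u x ^ 2 = ∑ i, u x i ^ 2 := fun x => Real.sq_sqrt (by positivity)
  have hL2 : ∀ x, ltfNorm u x ^ 2 = ∑ i, ∑ j, ltf u i j x ^ 2 := fun x =>
    Real.sq_sqrt (by positivity)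
  have hUc := continuous_fieldNorm hu
  have hLc := continuous_ltfNorm hu
  have hRe : R = fun x => fieldNorm u x ^ 2 + ltfNorm u x ^ 2 := by
    ext x
    rw [hU2, hL2]
  have hRc : Continuous R := by
    rw [hRe]
    fun_prop
  have hR0 : ∀ x, 0 ≤ R x := fun x => by positivity
  have hRi := integrableOn_of_continuous_of_isBounded hRc hb
  have hDi := (integrableOn_of_continuous_of_isBounded hDc hb).mono_set hSΩ
  have hI0 : 0 ≤ ∫ x in Ω, R x := integral_nonneg hR0
  rw [← ENNReal.ofReal_le_ofReal_iff (by positivity),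
    ofReal_integral_eq_lintegral_ofReal hDi (Filter.Eventually.of_forall hD0)]
  calc ∫⁻ x in S, ENNReal.ofReal (D x)
      ≤ ∫⁻ x in S, ENNReal.ofReal (n * n * C1 ^ 2) * ENNReal.ofReal (A x ^ 2) := by
        refine setLIntegral_mono' hSm fun x hx => ?_
        rw [← ENNReal.ofReal_mul (by positivity)]
        exact ENNReal.ofReal_le_ofReal (hDA x hx)
    _ = ENNReal.ofReal (n * n * C1 ^ 2) * ∫⁻ x in S, ENNReal.ofReal (A x ^ 2) :=
        lintegral_const_mul' _ _ ENNReal.ofReal_ne_top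
    _ ≤ ENNReal.ofReal (n * n * C1 ^ 2) * (C2 * ((∫⁻ x in Ω, ENNReal.ofReal (fieldNorm u x ^ 2)) +
          ∫⁻ x in Ω, ENNReal.ofReal (ltfNorm u x ^ 2))) := by
        gcongr
        exact hC2 _ _ hUc (fun x => Real.sqrt_nonneg _) hLc (fun x => Real.sqrt_nonneg _) t S hSm
          hSΩ fun x hx => ⟨ht2 x, hx.2⟩
    _ = ENNReal.ofReal (n * n * C1 ^ 2) * (C2 * ENNReal.ofReal (∫ x in Ω, R x)) := by
        rw [ofReal_integral_eq_lintegral_ofReal hRi (Filter.Eventually.of_forall hR0),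
          ← lintegral_add_left (by fun_prop), hRe]
        simp_rw [ENNReal.ofReal_add (sq_nonneg _) (sq_nonneg _)]
    _ ≤ _ := by
        have hC2le : C2 ≤ ENNReal.ofReal (C2.toReal + 1) :=
          (ENNReal.ofReal_toReal hC2top).symm.le.trans (ENNReal.ofReal_le_ofReal (by linarith))
        rw [mul_assoc ((n : ℝ) * n * C1 ^ 2) (C2.toReal + 1),
          ENNReal.ofReal_mul (show 0 ≤ (n : ℝ) * n * C1 ^ 2 by positivity),
          ENNReal.ofReal_mul (show 0 ≤ C2.toReal + 1 by positivity)]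
        exact mul_le_mul' le_rfl (mul_le_mul' hC2le le_rfl)

end Assembly

/-- **Conformal Korn inequality** (Theorem 1): for `n ≥ 3` and a nonempty bounded open
convex (hence Lipschitz) domain `Ω ⊂ ℝⁿ`, there is a constant `C > 0` such that
`∫_Ω (|u|² + |Du|²) ≤ C ∫_Ω (|u|² + |l(u)|²)` for every smooth vector field `u`. -/
theorem conformal_korn_inequality (n : ℕ) (hn : 3 ≤ n) (Ω : Set (Fin n → ℝ))
    (hne : Ω.Nonempty) (hopen : IsOpen Ω) (hbdd : Bornology.IsBounded Ω)
    (hconv : Convex ℝ Ω) :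
    ∃ C : ℝ, 0 < C ∧ ∀ u : (Fin n → ℝ) → Fin n → ℝ, ContDiff ℝ (⊤ : ℕ∞) u →
      (∫ x in Ω, ((∑ i, u x i ^ 2) + ∑ i, ∑ j, pd (fun y => u y j) i x ^ 2)) ≤
        C * ∫ x in Ω, ((∑ i, u x i ^ 2) + ∑ i, ∑ j, ltf u i j x ^ 2) := by
  have : Nonempty (Fin n) := ⟨⟨0, by omega⟩⟩
  have hcne : Ωᶜ.Nonempty := by
    rw [Set.nonempty_compl]
    rintro rfl
    exact NormedSpace.unbounded_univ ℝ (Fin n → ℝ) hbdd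
  obtain ⟨x₀, hx₀⟩ := hne
  obtain ⟨ρ, hρ, hball⟩ := Metric.isOpen_iff.1 hopen x₀ hx₀
  set r := ρ / 2 with hr
  have hr0 : 0 < r := by positivity
  set K := Metric.closedBall x₀ r with hKdef
  have hK : IsCompact K := isCompact_closedBall _ _
  have hKΩ : K ⊆ Ω := (Metric.closedBall_subset_ball (by linarith)).trans hball
  have hKc : ∀ y ∈ K, r ≤ Metric.infDist y Ωᶜ := fun y hy => by
    refine (Metric.le_infDist hcne).2 fun q hq => ?_
    by_contra! h
    refine hq (hball ?_)
    have h1 : dist y x₀ ≤ r := hy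
    have h2 := dist_triangle q y x₀
    rw [dist_comm q y] at h2
    rw [Metric.mem_ball]
    linarith
  let β : ContDiffBump x₀ := ⟨r / 2, r, by positivity, by linarith⟩
  set φ := β.normed volume with hφdef
  have hφ : ContDiff ℝ (⊤ : ℕ∞) φ := β.contDiff_normed
  have hφK : ∀ y, y ∉ K → φ y = 0 := fun y hy => by
    have h : y ∉ Function.support φ := by
      rw [hφdef, β.support_normed_eq]
      exact fun h => hy (Metric.ball_subset_closedBall h)
    simpa using h
  have hφ1 : ∫ y, φ y = 1 := β.integral_normed
  obtain ⟨κ, hκ, hcut⟩ := exists_cutoff hopen hbdd hcne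
  obtain ⟨C, hC0, hC⟩ := exists_setIntegral_sum_sq_pd_homAvg_le hn hφ hK hφK hbdd hconv hopen hcne
    hKΩ hr0 hKc hκ
  refine ⟨9 + 10 * C, by positivity, fun u hu' => ?_⟩
  have hu : ∀ j, ContDiff ℝ (⊤ : ℕ∞) (fun x => u x j) := fun j => contDiff_pi.1 hu' j
  have hUc : Continuous fun x => ∑ i, u x i ^ 2 :=
    continuous_finsetSum _ fun j _ => (hu j).continuous.pow 2
  have hDc : Continuous fun x => ∑ i, ∑ j, pd (fun y => u y j) i x ^ 2 :=
    continuous_finsetSum _ fun i _ => continuous_finsetSum _ fun j _ =>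
      (contDiff_pd (hu j) i).continuous.pow 2
  have hLc : Continuous fun x => ∑ i, ∑ j, ltf u i j x ^ 2 :=
    continuous_finsetSum _ fun i _ => continuous_finsetSum _ fun j _ =>
      (contDiff_ltf hu i j).continuous.pow 2
  have hUi := integrableOn_of_continuous_of_isBounded hUc hbdd
  have hDi := integrableOn_of_continuous_of_isBounded hDc hbdd
  have hLi := integrableOn_of_continuous_of_isBounded hLc hbdd
  obtain ⟨M, hM⟩ := exists_bound_pd_homAvg_comp hφ hK hφK hbdd hconv hKΩ hu
  set I := ∫ x in Ω, ((∑ i, u x i ^ 2) + ∑ i, ∑ j, ltf u i j x ^ 2) with hI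
  have hI' : I = (∫ x in Ω, ∑ i, u x i ^ 2) + ∫ x in Ω, ∑ i, ∑ j, ltf u i j x ^ 2 :=
    integral_add hUi hLi
  have hUp : 0 ≤ ∫ x in Ω, ∑ i, u x i ^ 2 := integral_nonneg fun x => by positivity
  have hLp : 0 ≤ ∫ x in Ω, ∑ i, ∑ j, ltf u i j x ^ 2 := integral_nonneg fun x => by positivity
  have key : ∀ ε : ℝ, 0 < ε → ∫ x in Ω, ∑ i, ∑ j, pd (fun y => u y j) i x ^ 2 ≤
      8 * (∫ x in Ω, ∑ i, ∑ j, ltf u i j x ^ 2) + 10 * (C * I + |M| * ε) := by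
    intro ε hε
    obtain ⟨t, ht, ⟨T, hT, hTΩ, htT⟩, ht0, ht2, htd, hvol⟩ := hcut (ENNReal.ofReal ε) (by simpa)
    set w : (Fin n → ℝ) → Fin n → ℝ := fun x j => homAvg φ (fun y => u y j) x (t x) with hw
    have hws : ∀ j, ContDiff ℝ (⊤ : ℕ∞) (fun x => w x j) := fun j =>
      contDiff_homAvg_comp hφ (hu j) ht hK hφK
    have huw : ∀ x, x ∉ T → w x = u x := fun x hx => by
      ext j
      simp [hw, homAvg, htT x hx, integral_mul_const, hφ1]
    refine (setIntegral_sum_sq_pd_le (by omega) hbdd hu hws hT hTΩ huw).trans ?_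
    gcongr
    have hWc : Continuous fun x => ∑ i, ∑ j, pd (fun y => w y j) i x ^ 2 :=
      continuous_finsetSum _ fun i _ => continuous_finsetSum _ fun j _ =>
        (contDiff_pd (hws j) i).continuous.pow 2
    have hWi := integrableOn_of_continuous_of_isBounded hWc hbdd
    set S := {x | x ∈ Ω ∧ κ * Metric.infDist x Ωᶜ ≤ t x} with hS
    set N := {x | x ∈ Ω ∧ t x < κ * Metric.infDist x Ωᶜ} with hN
    have hNm : MeasurableSet N := (hopen.inter (isOpen_lt ht.continuous
      (continuous_const.mul (Metric.continuous_infDist_pt _)))).measurableSet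
    have hSN : Ω = S ∪ N := by
      ext x
      simp only [hS, hN, Set.mem_union, Set.mem_ofPred_eq, ← and_or_left]
      exact ⟨fun h => ⟨h, le_or_gt _ _⟩, fun h => h.1⟩
    have hdisj : Disjoint S N := Set.disjoint_left.2 fun x h1 h2 => absurd h2.2 (not_lt.2 h1.2)
    have hNΩ : N ⊆ Ω := fun x hx => hx.1
    have hSΩ : S ⊆ Ω := fun x hx => hx.1
    have hsplit : ∫ x in Ω, ∑ i, ∑ j, pd (fun y => w y j) i x ^ 2 =
        (∫ x in S, ∑ i, ∑ j, pd (fun y => w y j) i x ^ 2) +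
          ∫ x in N, ∑ i, ∑ j, pd (fun y => w y j) i x ^ 2 := by
      conv_lhs => rw [hSN]
      exact setIntegral_union hdisj hNm (hWi.mono_set hSΩ) (hWi.mono_set hNΩ)
    rw [hsplit]
    refine add_le_add (hC u hu t ht ht0 ht2 htd) ?_
    have hNtop : volume N ≠ ⊤ := (hvol.trans ENNReal.ofReal_lt_top).ne
    calc _ ≤ ∫ x in N, |M| := by
          refine setIntegral_mono_on (hWi.mono_set hNΩ) (integrableOn_const hNtop) hNm
            fun x hx => ?_
          exact (hM t ht ht0 ht2 htd x hx.1).trans (le_abs_self M)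
      _ = |M| * volume.real N := by simp [mul_comm]
      _ ≤ |M| * ε := by
          gcongr
          exact ENNReal.toReal_le_of_le_ofReal hε.le hvol.le
  have key' : ∫ x in Ω, ∑ i, ∑ j, pd (fun y => u y j) i x ^ 2 ≤
      8 * (∫ x in Ω, ∑ i, ∑ j, ltf u i j x ^ 2) + 10 * (C * I) := by
    refine le_of_forall_pos_le_add fun ε hε => (key (ε / (10 * (|M| + 1))) (by positivity)).trans ?_
    have : 10 * (|M| * (ε / (10 * (|M| + 1)))) ≤ ε := by
      have h1 : 0 < |M| + 1 := by positivity
      rw [show 10 * (|M| * (ε / (10 * (|M| + 1)))) = ε * (|M| / (|M| + 1)) by field_simp]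
      exact mul_le_of_le_one_right hε.le ((div_le_one h1).2 (by linarith))
    linarith
  rw [integral_add hUi hDi]
  linarith
end

section
/- Let Ω ⊂ ℝ² be the open unit disk. Then there is NO constant C > 0 such that ∫_Ω (|u|² + |Du|²) dμ ≤ C ∫_Ω (|u|² + |l(u)|²) dμ holds for all smooth vector fields u : ℝ² → ℝ²; that is, the conformal Korn inequality fails in dimension n = 2. -/
open MeasureTheory Finset

/-- The identification of `ℝ²` with `ℂ`, as a real-linear map. -/
noncomputable def planeToComplex : (Fin 2 → ℝ) →L[ℝ] ℂ :=
  (ContinuousLinearMap.proj (R := ℝ) (φ := fun _ : Fin 2 => ℝ) 0).smulRight (1 : ℂ) +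
    (ContinuousLinearMap.proj (R := ℝ) (φ := fun _ : Fin 2 => ℝ) 1).smulRight Complex.I

lemma planeToComplex_re (x : Fin 2 → ℝ) : (planeToComplex x).re = x 0 := by
  simp [planeToComplex]

lemma planeToComplex_im (x : Fin 2 → ℝ) : (planeToComplex x).im = x 1 := by
  simp [planeToComplex]

lemma normSq_planeToComplex (x : Fin 2 → ℝ) :
    Complex.normSq (planeToComplex x) = x 0 ^ 2 + x 1 ^ 2 := by
  rw [Complex.normSq_apply, planeToComplex_re, planeToComplex_im]
  ring

lemma planeToComplex_single_zero : planeToComplex (Pi.single 0 1) = 1 := by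
  apply Complex.ext <;> simp [planeToComplex_re, planeToComplex_im]

lemma planeToComplex_single_one : planeToComplex (Pi.single 1 1) = Complex.I := by
  apply Complex.ext <;> simp [planeToComplex_re, planeToComplex_im]

/-- The vector field `z ↦ z ^ k` on the plane. -/
noncomputable def powField (k : ℕ) (x : Fin 2 → ℝ) : Fin 2 → ℝ :=
  ![(planeToComplex x ^ k).re, (planeToComplex x ^ k).im]

lemma contDiff_powField (k : ℕ) : ContDiff ℝ (⊤ : ℕ∞) (powField k) := by
  have h : ContDiff ℝ (⊤ : ℕ∞) fun x => planeToComplex x ^ k :=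
    planeToComplex.contDiff.pow k
  rw [contDiff_pi]
  intro i
  fin_cases i
  · exact Complex.reCLM.contDiff.comp h
  · exact Complex.imCLM.contDiff.comp h

lemma pd_comp_planeToComplex_pow (L : ℂ →L[ℝ] ℝ) (k : ℕ) (i : Fin 2) (x : Fin 2 → ℝ) :
    pd (fun y => L (planeToComplex y ^ k)) i x =
      L (k * planeToComplex x ^ (k - 1) * planeToComplex (Pi.single i 1)) := by
  have h : HasFDerivAt (fun y => L (planeToComplex y ^ k)) _ x :=
    L.hasFDerivAt.comp x ((planeToComplex.hasFDerivAt (x := x)).pow k)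
  rw [pd, h.fderiv]
  simp [mul_assoc]

section powFieldDerivatives

variable (k : ℕ) (x : Fin 2 → ℝ)

lemma pd_powField_zero_zero :
    pd (fun y => powField k y 0) 0 x = (k * planeToComplex x ^ (k - 1)).re := by
  simpa [powField, planeToComplex_single_zero] using
    pd_comp_planeToComplex_pow Complex.reCLM k 0 x

lemma pd_powField_zero_one :
    pd (fun y => powField k y 0) 1 x = -(k * planeToComplex x ^ (k - 1)).im := by
  simpa [powField, planeToComplex_single_one] using
    pd_comp_planeToComplex_pow Complex.reCLM k 1 x

lemma pd_powField_one_zero :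
    pd (fun y => powField k y 1) 0 x = (k * planeToComplex x ^ (k - 1)).im := by
  simpa [powField, planeToComplex_single_zero] using
    pd_comp_planeToComplex_pow Complex.imCLM k 0 x

lemma pd_powField_one_one :
    pd (fun y => powField k y 1) 1 x = (k * planeToComplex x ^ (k - 1)).re := by
  simpa [powField, planeToComplex_single_one] using
    pd_comp_planeToComplex_pow Complex.imCLM k 1 x

/-- By the Cauchy-Riemann equations, `z ↦ z ^ k` has vanishing trace-free strain. -/
lemma ltf_powField (i j : Fin 2) : ltf (powField k) i j x = 0 := by
  fin_cases i <;> fin_cases j <;>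
    simp [ltf, strain, diver, Fin.sum_univ_two, pd_powField_zero_zero k x,
      pd_powField_zero_one k x, pd_powField_one_zero k x, pd_powField_one_one k x] <;>
    ring

lemma sum_powField_sq : ∑ i, powField k x i ^ 2 = (x 0 ^ 2 + x 1 ^ 2) ^ k := by
  rw [← normSq_planeToComplex, ← map_pow, Complex.normSq_apply, Fin.sum_univ_two]
  simp [powField, sq]

lemma sum_pd_powField_sq :
    ∑ i, ∑ j, pd (fun y => powField k y j) i x ^ 2 =
      2 * (k : ℝ) ^ 2 * (x 0 ^ 2 + x 1 ^ 2) ^ (k - 1) := by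
  have h : Complex.normSq (k * planeToComplex x ^ (k - 1)) =
      (k : ℝ) ^ 2 * (x 0 ^ 2 + x 1 ^ 2) ^ (k - 1) := by
    rw [map_mul, map_pow, normSq_planeToComplex, Complex.normSq_natCast, sq (k : ℝ)]
  rw [Complex.normSq_apply] at h
  simp only [Fin.sum_univ_two, pd_powField_zero_zero, pd_powField_zero_one,
    pd_powField_one_zero, pd_powField_one_one]
  linear_combination 2 * h

end powFieldDerivatives

lemma isOpen_unitDisk : IsOpen {y : Fin 2 → ℝ | y 0 ^ 2 + y 1 ^ 2 < 1} :=
  isOpen_lt (by fun_prop) (by fun_prop)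

lemma integrableOn_unitDisk {f : (Fin 2 → ℝ) → ℝ} (hf : Continuous f) :
    IntegrableOn f {y : Fin 2 → ℝ | y 0 ^ 2 + y 1 ^ 2 < 1} := by
  refine (hf.continuousOn.integrableOn_compact
    (isCompact_closedBall (0 : Fin 2 → ℝ) 1)).mono_set ?_
  intro y hy
  rw [Set.mem_ofPred_eq] at hy
  rw [mem_closedBall_zero_iff, pi_norm_le_iff_of_nonneg zero_le_one]
  intro i
  rw [Real.norm_eq_abs, abs_le_one_iff_mul_self_le_one]
  fin_cases i
  · change y 0 * y 0 ≤ 1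
    nlinarith [sq_nonneg (y 1)]
  · change y 1 * y 1 ≤ 1
    nlinarith [sq_nonneg (y 0)]

lemma setIntegral_unitDisk_pow_pos (k : ℕ) :
    0 < ∫ x in {y : Fin 2 → ℝ | y 0 ^ 2 + y 1 ^ 2 < 1}, (x 0 ^ 2 + x 1 ^ 2) ^ k := by
  have hcont : Continuous fun x : Fin 2 → ℝ => (x 0 ^ 2 + x 1 ^ 2) ^ k := by fun_prop
  rw [setIntegral_pos_iff_support_of_nonneg_ae
    (Filter.Eventually.of_forall fun x => by positivity) (integrableOn_unitDisk hcont)]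
  refine (hcont.isOpen_support.inter isOpen_unitDisk).measure_pos _ ⟨![1 / 2, 0], ?_, ?_⟩
  · simp
  · norm_num

/-- The conformal Korn inequality fails in dimension `n = 2`: on the open unit disk
there is no constant `C > 0` with
`∫_Ω (|u|² + |Du|²) ≤ C ∫_Ω (|u|² + |l(u)|²)` for all smooth `u : ℝ² → ℝ²`. -/
theorem conformal_korn_fails_dim_two :
    ¬ ∃ C : ℝ, 0 < C ∧ ∀ u : (Fin 2 → ℝ) → Fin 2 → ℝ, ContDiff ℝ (⊤ : ℕ∞) u →
      (∫ x in {y : Fin 2 → ℝ | y 0 ^ 2 + y 1 ^ 2 < 1},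
          ((∑ i, u x i ^ 2) + ∑ i, ∑ j, pd (fun y => u y j) i x ^ 2)) ≤
        C * ∫ x in {y : Fin 2 → ℝ | y 0 ^ 2 + y 1 ^ 2 < 1},
          ((∑ i, u x i ^ 2) + ∑ i, ∑ j, ltf u i j x ^ 2) := by
  rintro ⟨C, -, h⟩
  obtain ⟨k, hk⟩ := exists_nat_gt C
  have hk' : C < 2 * ((k + 1 : ℕ) : ℝ) ^ 2 := by
    push_cast
    nlinarith [(Nat.cast_nonneg k : (0 : ℝ) ≤ k)]
  have hle := h (powField (k + 1)) (contDiff_powField (k + 1))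
  simp only [sum_powField_sq, sum_pd_powField_sq, ltf_powField, Nat.add_sub_cancel] at hle
  norm_num only [Finset.sum_const_zero, add_zero] at hle
  have hpos := setIntegral_unitDisk_pow_pos (k + 1)
  refine absurd (mul_lt_mul_of_pos_right hk' hpos) (not_lt.mpr (le_trans ?_ hle))
  rw [← integral_const_mul]
  refine setIntegral_mono_on (integrableOn_unitDisk (by fun_prop))
    (integrableOn_unitDisk (by fun_prop)) isOpen_unitDisk.measurableSet ?_
  intro x hx
  have hr : 0 ≤ x 0 ^ 2 + x 1 ^ 2 := by positivity
  have hpow : (x 0 ^ 2 + x 1 ^ 2) ^ (k + 1) ≤ (x 0 ^ 2 + x 1 ^ 2) ^ k :=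
    pow_le_pow_of_le_one hr (le_of_lt hx) k.le_succ
  have hmul := mul_le_mul_of_nonneg_left hpow
    (show (0 : ℝ) ≤ 2 * ((k + 1 : ℕ) : ℝ) ^ 2 by positivity)
  linarith [pow_nonneg hr (k + 1)]
end
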